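/- arXiv:2501.06569 — 5 statements merged into one kernel-verified Lean document; each statement's English description precedes it below -/
import Mathlib

section
/- Let s, t ≥ 3 be integers. (i) If s and t are both odd, then the palette index of the Cartesian product C_s □ P_t equals 4. (ii) If s is even, then the palette index of C_s □ P_t equals 2. -/
open SimpleGraph

/-- A proper edge coloring of `G` (colors in `ℕ`): distinct edges sharing a
vertex receive different colors. -/
def IsProperEdgeColoring {V : Type*} (G : SimpleGraph V) (f : Sym2 V → ℕ) : Prop :=
  ∀ e₁ ∈ G.edgeSet, ∀ e₂ ∈ G.edgeSet, e₁ ≠ e₂ → (∃ v, v ∈ e₁ ∧ v ∈ e₂) → f e₁ ≠ f e₂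

/-- The palette of a vertex `v` under an edge coloring `f`: the set of colors
assigned to the edges incident to `v`. -/
def palette {V : Type*} (G : SimpleGraph V) (f : Sym2 V → ℕ) (v : V) : Set ℕ :=
  {c | ∃ e ∈ G.edgeSet, v ∈ e ∧ f e = c}

/-- The number of distinct palettes of vertices of `G` with respect to `f`. -/
noncomputable def numPalettes {V : Type*} (G : SimpleGraph V) (f : Sym2 V → ℕ) : ℕ :=
  (Set.range (palette G f)).ncard

/-- The palette index `š(G)`: the minimum number of distinct vertex palettes
over all proper edge colorings of `G`. -/
noncomputable def paletteIndex {V : Type*} (G : SimpleGraph V) : ℕ :=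
  sInf {n | ∃ f, IsProperEdgeColoring G f ∧ numPalettes G f = n}

/-- The chromatic index `χ'(G)`: the minimum `n` such that `G` has a proper
edge coloring with colors from `{0, …, n-1}`. -/
noncomputable def chromIndex {V : Type*} (G : SimpleGraph V) : ℕ :=
  sInf {n | ∃ f, IsProperEdgeColoring G f ∧ ∀ e ∈ G.edgeSet, f e < n}

/-- The degree of a vertex. -/
noncomputable def vertDegree {V : Type*} (G : SimpleGraph V) (v : V) : ℕ :=
  (G.neighborSet v).ncard

/-- The maximum degree `Δ(G)`. -/
noncomputable def maxDeg {V : Type*} (G : SimpleGraph V) : ℕ :=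
  sSup (Set.range (vertDegree G))

/-- `G` is class 1 if `χ'(G) = Δ(G)`. -/
def IsClass1 {V : Type*} (G : SimpleGraph V) : Prop := chromIndex G = maxDeg G

/-- `G` is `r`-regular. -/
def IsRegularDeg {V : Type*} (G : SimpleGraph V) (r : ℕ) : Prop :=
  ∀ v, vertDegree G v = r

/-- A perfect matching: a set `M` of edges of `G` such that every vertex is
incident to exactly one edge of `M`. -/
def IsPerfectMatchingSet {V : Type*} (G : SimpleGraph V) (M : Set (Sym2 V)) : Prop :=
  M ⊆ G.edgeSet ∧ ∀ v : V, ∃! e, e ∈ M ∧ v ∈ e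

/-- The successor on the cycle. -/
def nx (s i : ℕ) : ℕ := if i + 1 = s then 0 else i + 1

/-- The predecessor on the cycle. -/
def pv (s i : ℕ) : ℕ := if i = 0 then s - 1 else i - 1

lemma nx_lt {s i : ℕ} (hi : i < s) : nx s i < s := by
  unfold nx; split_ifs <;> omega

lemma pv_lt {s i : ℕ} (hi : i < s) : pv s i < s := by
  unfold pv; split_ifs <;> omega

lemma cyc_sub {s : ℕ} (hs : 3 ≤ s) (u v : Fin s) :
    (u - v).val = 1 ↔ u.val = nx s v.val := by
  have hu := u.isLt
  have hv := v.isLt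
  unfold nx
  rw [Fin.sub_def]
  simp only
  by_cases h : v.val ≤ u.val
  · have : s - v.val + u.val = (u.val - v.val) + s := by omega
    rw [this, Nat.add_mod_right, Nat.mod_eq_of_lt (by omega)]
    split_ifs <;> omega
  · rw [Nat.mod_eq_of_lt (by omega)]
    split_ifs <;> omega

lemma adj_iff {s t : ℕ} (hs : 3 ≤ s) (a b : Fin s × Fin t) :
    (cycleGraph s □ pathGraph t).Adj a b ↔
      (b.1.val = nx s a.1.val ∧ b.2.val = a.2.val) ∨ (b.1.val = pv s a.1.val ∧ b.2.val = a.2.val) ∨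
      (b.1.val = a.1.val ∧ b.2.val = a.2.val + 1) ∨ (b.1.val = a.1.val ∧ b.2.val + 1 = a.2.val) := by
  rw [boxProd_adj, cycleGraph_adj', pathGraph_adj, cyc_sub hs, cyc_sub hs, Fin.ext_iff, Fin.ext_iff]
  have ha := a.1.isLt
  have hb := b.1.isLt
  have : a.1.val = nx s b.1.val ↔ b.1.val = pv s a.1.val := by
    unfold nx pv; split_ifs <;> omega
  rw [this]
  omega

lemma mem_palette_iff {V : Type*} (G : SimpleGraph V) (f : Sym2 V → ℕ) (v : V) (c : ℕ) :
    c ∈ palette G f v ↔ ∃ w, G.Adj v w ∧ f s(v, w) = c := by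
  unfold palette
  constructor
  · rintro ⟨e, he, hv, hc⟩
    obtain ⟨w, rfl⟩ := Sym2.mem_iff_exists.1 hv
    exact ⟨w, he, hc⟩
  · rintro ⟨w, hw, hc⟩
    exact ⟨s(v, w), hw, Sym2.mem_mk_left _ _, hc⟩

lemma proper_iff {V : Type*} (G : SimpleGraph V) (f : Sym2 V → ℕ) :
    IsProperEdgeColoring G f ↔
      ∀ v a b, G.Adj v a → G.Adj v b → f s(v, a) = f s(v, b) → a = b := by
  unfold IsProperEdgeColoring
  constructor
  · intro h v a b ha hb hab
    by_contra hne
    refine h s(v, a) ha s(v, b) hb ?_ ⟨v, Sym2.mem_mk_left _ _, Sym2.mem_mk_left _ _⟩ hab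
    intro he
    exact hne (Sym2.congr_right.1 he)
  · rintro h e₁ he₁ e₂ he₂ hne ⟨v, h1, h2⟩ hf
    obtain ⟨a, rfl⟩ := Sym2.mem_iff_exists.1 h1
    obtain ⟨b, rfl⟩ := Sym2.mem_iff_exists.1 h2
    exact hne (by rw [h v a b he₁ he₂ hf])

lemma palette_ncard {V : Type*} (G : SimpleGraph V) (f : Sym2 V → ℕ)
    (hf : IsProperEdgeColoring G f) (v : V) :
    (palette G f v).ncard = (G.neighborSet v).ncard := by
  have : palette G f v = (fun w => f s(v, w)) '' G.neighborSet v := by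
    ext c
    rw [mem_palette_iff]
    rfl
  rw [this]
  apply Set.InjOn.ncard_image
  intro a ha b hb hab
  exact (proper_iff G f).1 hf v a b ha hb hab

lemma even_of_matched {V : Type*} (G : SimpleGraph V) (f : Sym2 V → ℕ)
    (hf : IsProperEdgeColoring G f) (c : ℕ) (S : Finset V)
    (h : ∀ v ∈ S, ∃ w ∈ S, G.Adj v w ∧ f s(v, w) = c) : Even S.card := by
  choose g hgS hga hgc using h
  have := Finset.sum_involution (s := S) (f := fun _ => (1 : ZMod 2)) g
    (fun _ _ => by decide) (fun a ha _ => (hga a ha).ne') hgS (by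
      intro a ha
      refine (proper_iff G f).1 hf (g a ha) _ _ (hga _ _) (hga a ha).symm ?_
      rw [hgc, Sym2.eq_swap, hgc])
  rw [Finset.sum_const, nsmul_eq_mul, mul_one] at this
  exact (ZMod.natCast_eq_zero_iff_even).1 this

lemma nbr_end {s t : ℕ} (hs : 3 ≤ s) (ht : 3 ≤ t) (v : Fin s × Fin t)
    (hv : v.2.val = 0 ∨ v.2.val + 1 = t) :
    ((cycleGraph s □ pathGraph t).neighborSet v).ncard = 3 := by
  obtain ⟨⟨i, hi⟩, ⟨j, hj⟩⟩ := v
  simp only at hv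
  have hn : nx s i ≠ pv s i ∧ nx s i ≠ i ∧ pv s i ≠ i := by
    unfold nx pv; split_ifs <;> omega
  rw [Set.ncard_eq_three]
  refine ⟨(⟨nx s i, nx_lt hi⟩, ⟨j, hj⟩), (⟨pv s i, pv_lt hi⟩, ⟨j, hj⟩),
    (⟨i, hi⟩, ⟨if j = 0 then 1 else j - 1, by split_ifs <;> omega⟩), ?_, ?_, ?_, ?_⟩
  · simp [Prod.ext_iff, Fin.ext_iff, hn]
  · simp [Prod.ext_iff, Fin.ext_iff, hn]
  · simp [Prod.ext_iff, Fin.ext_iff, hn]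
  · ext ⟨⟨i', hi'⟩, ⟨j', hj'⟩⟩
    rw [mem_neighborSet, adj_iff hs]
    simp only [Set.mem_insert_iff, Set.mem_singleton_iff, Prod.ext_iff, Fin.ext_iff]
    split_ifs <;> omega

lemma nbr_int {s t : ℕ} (hs : 3 ≤ s) (v : Fin s × Fin t)
    (hv : ¬ (v.2.val = 0 ∨ v.2.val + 1 = t)) :
    ((cycleGraph s □ pathGraph t).neighborSet v).ncard = 4 := by
  obtain ⟨⟨i, hi⟩, ⟨j, hj⟩⟩ := v
  simp only at hv
  have hn : nx s i ≠ pv s i ∧ nx s i ≠ i ∧ pv s i ≠ i := by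
    unfold nx pv; split_ifs <;> omega
  have : (cycleGraph s □ pathGraph t).neighborSet (⟨i, hi⟩, ⟨j, hj⟩) =
    (({(⟨nx s i, nx_lt hi⟩, ⟨j, hj⟩), (⟨pv s i, pv_lt hi⟩, ⟨j, hj⟩),
    (⟨i, hi⟩, ⟨j + 1, by omega⟩), (⟨i, hi⟩, ⟨j - 1, by omega⟩)} : Finset (Fin s × Fin t)) : Set _) := by
    ext ⟨⟨i', hi'⟩, ⟨j', hj'⟩⟩
    rw [mem_neighborSet, adj_iff hs]
    simp only [Finset.coe_insert, Finset.coe_singleton, Set.mem_insert_iff,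
      Set.mem_singleton_iff, Prod.ext_iff, Fin.ext_iff]
    omega
  rw [this, Set.ncard_coe_finset]
  repeat rw [Finset.card_insert_of_notMem]
  · simp
  all_goals
    simp only [Finset.mem_insert, Finset.mem_singleton, Prod.ext_iff, Fin.ext_iff]
    omega

/-- Construction of a coloring from horizontal colors `h` and vertical colors `w`. -/
lemma exists_coloring {s t : ℕ} (hs : 3 ≤ s) (h w : ℕ → ℕ → ℕ) (P : ℕ → ℕ → Set ℕ)
    (h1 : ∀ i j, i < s → j < t → h i j ≠ h (pv s i) j)
    (h2 : ∀ i j, i < s → j + 1 < t → w i j ≠ h i j ∧ w i j ≠ h (pv s i) j)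
    (h3 : ∀ i j, i < s → j + 1 < t → w i j ≠ h i (j + 1) ∧ w i j ≠ h (pv s i) (j + 1))
    (h4 : ∀ i j, i < s → j + 2 < t → w i j ≠ w i (j + 1))
    (hP : ∀ i j, i < s → j < t → ∀ c, c ∈ P i j ↔ (c = h i j ∨ c = h (pv s i) j ∨
      (j + 1 < t ∧ c = w i j) ∨ (0 < j ∧ c = w i (j - 1)))) :
    ∃ f, IsProperEdgeColoring (cycleGraph s □ pathGraph t) f ∧
      ∀ v, palette (cycleGraph s □ pathGraph t) f v = P v.1.val v.2.val := by
  classical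
  let g : (Fin s × Fin t) → (Fin s × Fin t) → ℕ := fun p q =>
    if p.2.val = q.2.val then
      (if q.1.val = nx s p.1.val then h p.1.val p.2.val else 0) +
      (if p.1.val = nx s q.1.val then h q.1.val q.2.val else 0)
    else w (min p.1.val q.1.val) (min p.2.val q.2.val)
  have hg : ∀ p q, g p q = g q p := by
    intro p q
    simp only [g]
    rw [add_comm, min_comm p.1.val, min_comm p.2.val]
    simp only [eq_comm (a := p.2.val)]
  let f : Sym2 (Fin s × Fin t) → ℕ := Sym2.lift ⟨g, hg⟩
  have hfg : ∀ p q, f s(p, q) = g p q := fun p q => rfl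
  have hcol : ∀ a b c, (cycleGraph s □ pathGraph t).Adj a b ∧ f s(a, b) = c ↔
      ((b.1.val = nx s a.1.val ∧ b.2.val = a.2.val ∧ c = h a.1.val a.2.val) ∨
       (b.1.val = pv s a.1.val ∧ b.2.val = a.2.val ∧ c = h (pv s a.1.val) a.2.val) ∨
       (b.1.val = a.1.val ∧ b.2.val = a.2.val + 1 ∧ c = w a.1.val a.2.val) ∨
       (b.1.val = a.1.val ∧ b.2.val + 1 = a.2.val ∧ c = w a.1.val (a.2.val - 1))) := by
    rintro ⟨⟨i, hi⟩, ⟨j, hj⟩⟩ ⟨⟨i', hi'⟩, ⟨j', hj'⟩⟩ c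
    rw [adj_iff hs, hfg]
    simp only [g]
    have e1 : i = nx s i' ↔ i' = pv s i := by
      unfold nx pv; split_ifs <;> omega
    have e2 : nx s i ≠ pv s i := by
      unfold nx pv; split_ifs <;> omega
    simp only [e1]
    constructor
    · rintro ⟨⟨rfl, rfl⟩ | ⟨rfl, rfl⟩ | ⟨rfl, rfl⟩ | ⟨rfl, rfl⟩, hc⟩
      · left; simp [e2] at hc; simp [hc]
      · right; left; simp [e2.symm] at hc; simp [hc]
      · right; right; left; simp at hc; simp [hc]
      · right; right; right; simp at hc; simp [hc]
    · rintro (⟨rfl, rfl, rfl⟩ | ⟨rfl, rfl, rfl⟩ | ⟨rfl, rfl, rfl⟩ | ⟨rfl, rfl, rfl⟩)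
      · simp [e2]
      · simp [e2.symm]
      · simp
      · simp
  refine ⟨f, ?_, ?_⟩
  · rw [proper_iff]
    intro v a b ha hb hab
    have A := (hcol v a _).1 ⟨ha, rfl⟩
    have B := (hcol v b _).1 ⟨hb, hab.symm⟩
    generalize f s(v, a) = c at A B
    obtain ⟨⟨i, hi⟩, ⟨j, hj⟩⟩ := v
    obtain ⟨⟨i', hi'⟩, ⟨j', hj'⟩⟩ := a
    obtain ⟨⟨k, hk⟩, ⟨l, hl⟩⟩ := b
    simp only [Prod.mk.injEq, Fin.mk.injEq] at A B ⊢
    have H1 := h1 i j hi hj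
    have H2 := h2 i j hi
    have H3 := h3 i (j - 1) hi
    have H4 := h4 i (j - 1) hi
    rcases Nat.eq_zero_or_pos j with h0 | h0
    · clear H3 H4
      rcases A with A | A | A | A <;> rcases B with B | B | B | B <;> omega
    · rw [show j - 1 + 1 = j by omega] at H3 H4
      rw [show j - 1 + 2 = j + 1 by omega] at H4
      rcases A with A | A | A | A <;> rcases B with B | B | B | B <;> omega
  · intro v
    ext c
    rw [mem_palette_iff, hP _ _ v.1.isLt v.2.isLt]
    simp only [hcol]
    obtain ⟨⟨i, hi⟩, ⟨j, hj⟩⟩ := v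
    simp only
    constructor
    · rintro ⟨⟨⟨i', hi'⟩, ⟨j', hj'⟩⟩, hh⟩
      simp only at hh
      omega
    · rintro (hc | hc | ⟨hj1, hc⟩ | ⟨hj1, hc⟩)
      · exact ⟨(⟨nx s i, nx_lt hi⟩, ⟨j, hj⟩), by simp [hc]⟩
      · exact ⟨(⟨pv s i, pv_lt hi⟩, ⟨j, hj⟩), by simp [hc]⟩
      · exact ⟨(⟨i, hi⟩, ⟨j + 1, hj1⟩), by simp [hc]⟩
      · exact ⟨(⟨i, hi⟩, ⟨j - 1, by omega⟩), by simp [hc]; omega⟩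

lemma even_coloring {s t : ℕ} (hs : 3 ≤ s) (ht : 3 ≤ t) (he : Even s) :
    ∃ f, IsProperEdgeColoring (cycleGraph s □ pathGraph t) f ∧
      numPalettes (cycleGraph s □ pathGraph t) f ≤ 2 := by
  have he' : s % 2 = 0 := Nat.even_iff.1 he
  obtain ⟨f, hf, hp⟩ := exists_coloring (s := s) (t := t) hs
    (fun i j => if i % 2 = 0 then 0 else if j = 0 then 2 else
      if j + 1 = t then (if t % 2 = 0 then 2 else 1) else 3)
    (fun _ j => if j % 2 = 0 then 1 else 2)
    (fun _ j => {c | c < 3 ∨ (c = 3 ∧ 0 < j ∧ j + 1 < t)})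
    (by intro i j hi hj; unfold pv; grind)
    (by intro i j hi hj; unfold pv; grind)
    (by intro i j hi hj; unfold pv; grind)
    (by intro i j hi hj; grind)
    (by
      intro i j hi hj c
      have e1 : pv s i % 2 = 1 - i % 2 := by unfold pv; split_ifs <;> omega
      simp only [e1, Set.mem_ofPred_eq]
      split_ifs <;> omega)
  refine ⟨f, hf, ?_⟩
  have hsub : Set.range (palette (cycleGraph s □ pathGraph t) f) ⊆
      ({{c | c < 3}, {c | c < 4}} : Set (Set ℕ)) := by
    rintro _ ⟨v, rfl⟩
    rw [hp]
    simp only [Set.mem_insert_iff, Set.mem_singleton_iff, Set.ext_iff, Set.mem_ofPred_eq]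
    by_cases h : 0 < v.2.val ∧ v.2.val + 1 < t
    · right; omega
    · left; omega
  exact (Set.ncard_le_ncard hsub (by simp)).trans (Set.ncard_insert_le _ _ |>.trans (by simp))

lemma odd_coloring {s t : ℕ} (hs : 3 ≤ s) (ht : 3 ≤ t) (hos : Odd s) (hot : Odd t) :
    ∃ f, IsProperEdgeColoring (cycleGraph s □ pathGraph t) f ∧
      numPalettes (cycleGraph s □ pathGraph t) f ≤ 4 := by
  have hs' : s % 2 = 1 := Nat.odd_iff.1 hos
  have ht' : t % 2 = 1 := Nat.odd_iff.1 hot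
  obtain ⟨f, hf, hp⟩ := exists_coloring (s := s) (t := t) hs
    (fun i j => if j = 0 then (if i + 1 = s then 4 else i % 2) else
      if i + 1 = s then 1 else if i % 2 = 1 then 0 else if j + 1 = t then 2 else 3)
    (fun i j => if j % 2 = 0 then (if i + 1 = s then 3 else 2) else
      if i + 1 = s then 2 else if i = 0 then 0 else 1)
    (fun i j => if j = 0 then (if i = 0 then {0, 2, 4} else if i + 1 = s then {1, 3, 4} else {0, 1, 2})
      else if j + 1 = t then {0, 1, 2} else {0, 1, 2, 3})
    (by intro i j hi hj; unfold pv; grind)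
    (by intro i j hi hj; unfold pv; grind)
    (by intro i j hi hj; unfold pv; grind)
    (by intro i j hi hj; grind)
    (by
      intro i j hi hj c
      have p0 : i = 0 → pv s i + 1 = s := by unfold pv; split_ifs <;> omega
      have p1 : i ≠ 0 → pv s i + 1 ≠ s ∧ pv s i % 2 = 1 - i % 2 := by
        unfold pv; split_ifs <;> omega
      generalize pv s i = k at p0 p1
      have q : j ≠ 0 → (j - 1) % 2 = 1 - j % 2 := by omega
      have e0 : (if j = 0 then (if i = 0 then ({0, 2, 4} : Set ℕ) else
          if i + 1 = s then {1, 3, 4} else {0, 1, 2})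
          else if j + 1 = t then {0, 1, 2} else {0, 1, 2, 3}) =
          {c | if j = 0 then (if i = 0 then c = 0 ∨ c = 2 ∨ c = 4 else
          if i + 1 = s then c = 1 ∨ c = 3 ∨ c = 4 else c = 0 ∨ c = 1 ∨ c = 2)
          else if j + 1 = t then c = 0 ∨ c = 1 ∨ c = 2 else c = 0 ∨ c = 1 ∨ c = 2 ∨ c = 3} := by
        ext c
        simp only [Set.mem_ofPred_eq]
        split_ifs <;> simp
      simp only [e0, Set.mem_ofPred_eq]
      generalize j - 1 = l at q
      by_cases hj0 : j = 0
      · simp only [hj0, if_true]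
        by_cases hi0 : i = 0
        · simp only [hi0, p0 hi0, if_true]; grind
        · simp only [hi0, if_false, (p1 hi0).1, (p1 hi0).2]; grind
      · simp only [hj0, if_false, q hj0]
        by_cases hi0 : i = 0
        · simp only [hi0, p0 hi0, if_true]; grind
        · simp only [hi0, if_false, (p1 hi0).1, (p1 hi0).2]; grind)
  refine ⟨f, hf, ?_⟩
  have hsub : Set.range (palette (cycleGraph s □ pathGraph t) f) ⊆
      (({{0, 2, 4}, {1, 3, 4}, {0, 1, 2}, {0, 1, 2, 3}} : Set (Set ℕ))) := by
    rintro _ ⟨v, rfl⟩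
    rw [hp]
    split_ifs <;> simp
  refine (Set.ncard_le_ncard hsub (by simp)).trans ?_
  refine (Set.ncard_insert_le _ _).trans ?_
  have := Set.ncard_insert_le ({1, 3, 4} : Set ℕ) {{0, 1, 2}, {0, 1, 2, 3}}
  have h2 := Set.ncard_insert_le ({0, 1, 2} : Set ℕ) {{0, 1, 2, 3}}
  rw [Set.ncard_singleton] at h2
  omega

lemma two_le {s t : ℕ} (hs : 3 ≤ s) (ht : 3 ≤ t) (f : Sym2 (Fin s × Fin t) → ℕ)
    (hf : IsProperEdgeColoring (cycleGraph s □ pathGraph t) f) :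
    2 ≤ numPalettes (cycleGraph s □ pathGraph t) f := by
  have a := palette_ncard _ f hf (⟨0, by omega⟩, ⟨0, by omega⟩)
  have b := palette_ncard _ f hf (⟨0, by omega⟩, ⟨1, by omega⟩)
  rw [nbr_end hs ht _ (by simp)] at a
  rw [nbr_int hs _ (by simp; omega)] at b
  unfold numPalettes
  have : 1 < (Set.range (palette (cycleGraph s □ pathGraph t) f)).ncard := by
    rw [Set.one_lt_ncard (Set.finite_range _)]
    refine ⟨_, ⟨(⟨0, by omega⟩, ⟨0, by omega⟩), rfl⟩, _,
      ⟨(⟨0, by omega⟩, ⟨1, by omega⟩), rfl⟩, fun h => ?_⟩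
    rw [h, b] at a
    omega
  exact this

open Classical in
lemma two_val {V : Type*} (P : V → Set ℕ) (S : Finset V) (A B : Set ℕ)
    (h : ∀ v ∈ S, P v = A ∨ P v = B) :
    ∃ m n, m + n = S.card ∧ ∀ c, (S.filter (fun v => c ∈ P v)).card =
      (if c ∈ A then m else 0) + (if c ∈ B then n else 0) := by
  refine ⟨(S.filter (fun v => P v = A)).card, (S.filter (fun v => ¬ P v = A)).card,
    Finset.card_filter_add_card_filter_not _, fun c => ?_⟩
  rw [← Finset.card_filter_add_card_filter_not (s := S.filter (fun v => c ∈ P v))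
    (fun v => P v = A), Finset.filter_filter, Finset.filter_filter]
  congr 1
  · split_ifs with hc
    · congr 1
      apply Finset.filter_congr
      intro v hv
      constructor
      · exact fun h => h.2
      · exact fun h => ⟨h ▸ hc, h⟩
    · rw [Finset.card_eq_zero, Finset.filter_eq_empty_iff]
      rintro v hv ⟨h1, h2⟩
      exact hc (h2 ▸ h1)
  · split_ifs with hc
    · congr 1
      apply Finset.filter_congr
      intro v hv
      constructor
      · exact fun h => h.2
      · intro hn
        exact ⟨(h v hv).resolve_left hn ▸ hc, hn⟩
    · rw [Finset.card_eq_zero, Finset.filter_eq_empty_iff]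
      rintro v hv ⟨h1, h2⟩
      exact hc ((h v hv).resolve_left h2 ▸ h1)

lemma three_vals {V : Type*} [Finite V] (P : V → Set ℕ) (hr : (Set.range P).ncard ≤ 3)
    (a b c : V) (hab : P a ≠ P b) (hac : P a ≠ P c) (hbc : P b ≠ P c) (v : V) :
    P v = P a ∨ P v = P b ∨ P v = P c := by
  by_contra hcon
  push Not at hcon
  have hsub : ({P v, P a, P b, P c} : Set (Set ℕ)) ⊆ Set.range P := by
    rintro x (rfl | rfl | rfl | rfl) <;> exact ⟨_, rfl⟩
  have := Set.ncard_le_ncard hsub (Set.finite_range _)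
  rw [Set.ncard_insert_of_notMem (by simp [hcon]), Set.ncard_insert_of_notMem (by simp [hab, hac]),
    Set.ncard_pair hbc] at this
  omega

/-- The combinatorial core of the lower bound. -/
lemma core {V : Type*} [Fintype V] [DecidableEq V] (P : V → Set ℕ) (E : Finset V)
    (hE : Even E.card) (hEne : E.Nonempty)
    (hI : Odd ((Finset.univ.filter (fun v => v ∉ E)).card))
    (h3 : ∀ v ∈ E, (P v).ncard = 3) (h4 : ∀ v, v ∉ E → (P v).ncard = 4)
    (hpar : ∀ c, ∀ S : Finset V, (∀ v, v ∈ S ↔ c ∈ P v) → Even S.card)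
    (hx : ∀ x, (∀ v ∈ E, x ∈ P v) → (∀ v, v ∉ E → x ∉ P v) → False)
    (hr : (Set.range P).ncard ≤ 3) : False := by
  classical
  set I := Finset.univ.filter (fun v => v ∉ E) with hIdef
  have hmI : ∀ v, v ∈ I ↔ v ∉ E := by simp [I]
  have hsum : ∀ c, Even ((E.filter (fun v => c ∈ P v)).card + (I.filter (fun v => c ∈ P v)).card) := by
    intro c
    rw [← Finset.card_union_of_disjoint]
    · apply hpar c
      intro v
      simp only [Finset.mem_union, Finset.mem_filter, hmI]
      tauto
    · rw [Finset.disjoint_left]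
      intro v hv hv'
      rw [Finset.mem_filter] at hv hv'
      exact (hmI v).1 hv'.1 hv.1
  obtain ⟨e, he⟩ := hEne
  have hIne : I.Nonempty := by
    rw [← Finset.card_pos]
    exact hI.pos
  obtain ⟨b, hb⟩ := hIne
  rw [hmI] at hb
  have hneq : ∀ v ∈ E, ∀ w, w ∉ E → P v ≠ P w := by
    intro v hv w hw h
    have := h3 v hv
    rw [h, h4 w hw] at this
    omega
  have hne4 : ∀ w, w ∉ E → ∃ c, c ∈ P w := by
    intro w hw
    apply Set.nonempty_of_ncard_ne_zero
    rw [h4 w hw]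
    omega
  rw [Nat.even_iff] at hE
  rw [Nat.odd_iff] at hI
  simp only [Nat.even_iff] at hsum
  by_cases hA : ∀ v ∈ E, P v = P e
  · -- one end palette
    obtain ⟨m, n, hmn, hc⟩ := two_val P E (P e) (P e) (fun v hv => Or.inl (hA v hv))
    have hI2 : ∃ b', b' ∉ E ∧ ∀ v ∈ I, P v = P b ∨ P v = P b' := by
      by_cases hB : ∀ v, v ∉ E → P v = P b
      · exact ⟨b, hb, fun v hv => Or.inl (hB v ((hmI v).1 hv))⟩
      · push Not at hB
        obtain ⟨b', hb', hbb⟩ := hB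
        refine ⟨b', hb', fun v hv => ?_⟩
        have := three_vals P hr e b b' (hneq _ he _ hb) (hneq _ he _ hb') hbb.symm v
        exact this.resolve_left (hneq _ he _ ((hmI v).1 hv)).symm
    obtain ⟨b', hb', hI2⟩ := hI2
    obtain ⟨p, q, hpq, hd⟩ := two_val P I (P b) (P b') hI2
    obtain ⟨x, hxb⟩ := hne4 b hb
    obtain ⟨y, hyb⟩ := hne4 b' hb'
    have h1 := hsum x
    have h2 := hsum y
    rw [hc, hd] at h1 h2
    simp only [hxb, hyb, if_true] at h1 h2
    split_ifs at h1 h2 <;> omega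
  · push Not at hA
    obtain ⟨e', he', hee⟩ := hA
    have hall := three_vals P hr e e' b hee.symm (hneq _ he _ hb) (hneq _ he' _ hb)
    have hEv : ∀ v ∈ E, P v = P e ∨ P v = P e' := fun v hv => by
      rcases hall v with h | h | h
      · exact Or.inl h
      · exact Or.inr h
      · exact absurd h (hneq _ hv _ hb)
    have hIv : ∀ v, v ∉ E → P v = P b := fun v hv => by
      rcases hall v with h | h | h
      · exact absurd h.symm (hneq _ he _ hv)
      · exact absurd h.symm (hneq _ he' _ hv)
      · exact h
    obtain ⟨m, n, hmn, hc⟩ := two_val P E (P e) (P e') hEv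
    obtain ⟨p, q, hpq, hd⟩ := two_val P I (P b) (P b) (fun v hv => Or.inl (hIv v ((hmI v).1 hv)))
    simp only [hc, hd] at hsum
    have hodd : m % 2 = 1 := by
      obtain ⟨x, hxb⟩ := hne4 b hb
      have h1 := hsum x
      simp only [hxb, if_true] at h1
      split_ifs at h1 <;> omega
    have hB : ∀ x ∈ P b, x ∉ P e ∩ P e' := by
      rintro x hx ⟨h1, h2⟩
      have h3 := hsum x
      simp only [hx, h1, h2, if_true] at h3
      omega
    have hnB : ∀ x, x ∉ P b → (x ∈ P e ∪ P e') → x ∈ P e ∩ P e' := by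
      rintro x hx h1
      have h3 := hsum x
      simp only [hx, if_false] at h3
      by_cases k1 : x ∈ P e <;> by_cases k2 : x ∈ P e'
      · exact ⟨k1, k2⟩
      · simp only [k1, k2, if_true, if_false] at h3; omega
      · simp only [k1, k2, if_true, if_false] at h3; omega
      · exact absurd h1 (by simp [k1, k2])
    have hfe : (P e).Finite := Set.finite_of_ncard_ne_zero (by rw [h3 e he]; omega)
    have hfe' : (P e').Finite := Set.finite_of_ncard_ne_zero (by rw [h3 e' he']; omega)
    have hfb : (P b).Finite := Set.finite_of_ncard_ne_zero (by rw [h4 b hb]; omega)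
    have hcard := Set.ncard_union_add_ncard_inter (P e) (P e') hfe hfe'
    rw [h3 e he, h3 e' he'] at hcard
    rcases Set.eq_empty_or_nonempty (P e ∩ P e') with h0 | ⟨x, hxx⟩
    · have hsub : P e ∪ P e' ⊆ P b := by
        intro x hx
        by_contra hxb
        have := hnB x hxb hx
        rw [h0] at this
        exact this
      have := Set.ncard_le_ncard hsub hfb
      rw [h4 b hb] at this
      rw [h0, Set.ncard_empty] at hcard
      omega
    · apply hx x
      · intro v hv
        rcases hEv v hv with h | h <;> rw [h]
        · exact hxx.1
        · exact hxx.2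
      · intro v hv hxv
        rw [hIv v hv] at hxv
        exact hB x hxv hxx

lemma four_le {s t : ℕ} (hs : 3 ≤ s) (ht : 3 ≤ t) (hos : Odd s) (hot : Odd t)
    (f : Sym2 (Fin s × Fin t) → ℕ)
    (hf : IsProperEdgeColoring (cycleGraph s □ pathGraph t) f) :
    4 ≤ numPalettes (cycleGraph s □ pathGraph t) f := by
  classical
  by_contra hlt
  have hs' := Nat.odd_iff.1 hos
  have ht' := Nat.odd_iff.1 hot
  have hrow : ∀ x : Fin t, ((Finset.univ : Finset (Fin s × Fin t)).filter
      (fun v => v.2 = x)).card = s := by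
    intro x
    have : (Finset.univ : Finset (Fin s × Fin t)).filter (fun v => v.2 = x) =
        Finset.univ ×ˢ {x} := by
      ext v; simp [Prod.ext_iff]; exact eq_comm
    rw [this, Finset.card_product]
    simp
  set E := (Finset.univ : Finset (Fin s × Fin t)).filter
    (fun v => v.2.val = 0 ∨ v.2.val + 1 = t) with hEdef
  have hmE : ∀ v, v ∈ E ↔ (v.2.val = 0 ∨ v.2.val + 1 = t) := by simp [E]
  have hEcard : E.card = 2 * s := by
    have : E = (Finset.univ : Finset (Fin s × Fin t)).filter (fun v => v.2 = ⟨0, by omega⟩) ∪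
        (Finset.univ : Finset (Fin s × Fin t)).filter (fun v => v.2 = ⟨t - 1, by omega⟩) := by
      ext v
      rw [hmE]
      simp only [Finset.mem_union, Finset.mem_filter, Finset.mem_univ, true_and, Fin.ext_iff]
      omega
    rw [this, Finset.card_union_of_disjoint, hrow, hrow]
    · omega
    · rw [Finset.disjoint_left]
      intro v hv hv'
      simp only [Finset.mem_filter, Finset.mem_univ, true_and, Fin.ext_iff] at hv hv'
      omega
  have htot := Finset.card_filter_add_card_filter_not
    (s := (Finset.univ : Finset (Fin s × Fin t))) (fun v => v ∈ E)
  have hEE : (Finset.univ : Finset (Fin s × Fin t)).filter (fun v => v ∈ E) = E := by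
    ext v; simp
  rw [hEE, hEcard, Finset.card_univ, Fintype.card_prod, Fintype.card_fin, Fintype.card_fin] at htot
  have hst := Nat.odd_iff.1 (hos.mul hot)
  refine core (palette (cycleGraph s □ pathGraph t) f) E ?_ ?_ ?_ ?_ ?_ ?_ ?_ ?_
  · rw [hEcard]; exact even_two_mul s
  · rw [← Finset.card_pos]; omega
  · rw [Nat.odd_iff]; omega
  · intro v hv
    rw [palette_ncard _ f hf, nbr_end hs ht v ((hmE v).1 hv)]
  · intro v hv
    rw [palette_ncard _ f hf, nbr_int hs v (fun h => hv ((hmE v).2 h))]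
  · intro c S hS
    apply even_of_matched _ f hf c S
    intro v hv
    obtain ⟨w, hw, hc⟩ := (mem_palette_iff _ _ _ _).1 ((hS v).1 hv)
    refine ⟨w, (hS w).2 ((mem_palette_iff _ _ _ _).2 ⟨v, hw.symm, ?_⟩), hw, hc⟩
    rw [Sym2.eq_swap, hc]
  · intro x h1 h2
    have := even_of_matched _ f hf x ((Finset.univ : Finset (Fin s × Fin t)).filter
      (fun v => v.2 = ⟨0, by omega⟩)) (by
        intro v hv
        simp only [Finset.mem_filter, Finset.mem_univ, true_and] at hv
        have hv0 : v.2.val = 0 := by rw [hv]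
        obtain ⟨w, hw, hc⟩ := (mem_palette_iff _ _ _ _).1 (h1 v ((hmE v).2 (Or.inl hv0)))
        refine ⟨w, ?_, hw, hc⟩
        by_contra hwr
        simp only [Finset.mem_filter, Finset.mem_univ, true_and, Fin.ext_iff] at hwr
        have hadj := (adj_iff hs v w).1 hw
        refine h2 w ?_ ((mem_palette_iff _ _ _ _).2 ⟨v, hw.symm, by rw [Sym2.eq_swap, hc]⟩)
        rw [hmE]
        omega)
    rw [hrow, Nat.even_iff] at this
    omega
  · unfold numPalettes at hlt
    omega

/-- For `s, t ≥ 3`: (i) if `s` and `t` are both odd then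
`š(C_s □ P_t) = 4`; (ii) if `s` is even then `š(C_s □ P_t) = 2`. -/
theorem paletteIndex_cycle_boxProd_path_partial (s t : ℕ) (hs : 3 ≤ s) (ht : 3 ≤ t) :
    (Odd s ∧ Odd t → paletteIndex (cycleGraph s □ pathGraph t) = 4) ∧
    (Even s → paletteIndex (cycleGraph s □ pathGraph t) = 2) := by

  have key : ∀ n, (∀ f, IsProperEdgeColoring (cycleGraph s □ pathGraph t) f →
      n ≤ numPalettes (cycleGraph s □ pathGraph t) f) →
      (∃ f, IsProperEdgeColoring (cycleGraph s □ pathGraph t) f ∧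
      numPalettes (cycleGraph s □ pathGraph t) f ≤ n) →
      paletteIndex (cycleGraph s □ pathGraph t) = n := by
    rintro n h1 ⟨f, hf, hn⟩
    apply le_antisymm
    · exact (Nat.sInf_le (⟨f, hf, rfl⟩ : _ ∈ {n | ∃ f, IsProperEdgeColoring (cycleGraph s □ pathGraph t) f ∧
        numPalettes (cycleGraph s □ pathGraph t) f = n})).trans hn
    · refine le_csInf ⟨numPalettes (cycleGraph s □ pathGraph t) f, f, hf, rfl⟩ ?_
      rintro m ⟨f', hf', rfl⟩
      exact h1 f' hf'
  exact ⟨fun h => key 4 (four_le hs ht h.1 h.2) (odd_coloring hs ht h.1 h.2),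
    fun h => key 2 (two_le hs ht) (even_coloring hs ht h)⟩
end

section
/- Let s, t ≥ 3 be integers. The palette index of the Cartesian product C_s □ P_t equals 4 if s and t are both odd, and equals 2 otherwise. -/
open SimpleGraph

abbrev CP (s t : ℕ) : SimpleGraph (Fin s × Fin t) := cycleGraph s □ pathGraph t

def rightOf (s a b : ℕ) : Prop := a + 1 = b ∨ (a + 1 = s ∧ b = 0)

instance (s a b : ℕ) : Decidable (rightOf s a b) := by unfold rightOf; infer_instance

lemma cycle_adj_iff {s : ℕ} (hs : 3 ≤ s) (a b : Fin s) :
    (cycleGraph s).Adj a b ↔ rightOf s a b ∨ rightOf s b a := by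
  obtain ⟨a, ha⟩ := a
  obtain ⟨b, hb⟩ := b
  rw [cycleGraph_adj', Fin.sub_def, Fin.sub_def]
  simp only [rightOf]
  have key : ∀ x y : ℕ, x < s → y < s → ((s - y + x) % s = 1 ↔ (y + 1 = x ∨ (y + 1 = s ∧ x = 0))) := by
    intro x y hx hy
    rcases lt_or_ge (s - y + x) s with h | h
    · rw [Nat.mod_eq_of_lt h]; omega
    · rw [Nat.mod_eq_sub_mod h, Nat.mod_eq_of_lt (by omega)]; omega
  rw [key a b ha hb, key b a hb ha]
  omega


lemma CP_adj {s t : ℕ} (hs : 3 ≤ s) (p q : Fin s × Fin t) :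
    (CP s t).Adj p q ↔
      ((rightOf s p.1 q.1 ∨ rightOf s q.1 p.1) ∧ p.2.val = q.2.val) ∨
      ((p.2.val + 1 = q.2.val ∨ q.2.val + 1 = p.2.val) ∧ p.1.val = q.1.val) := by
  rw [boxProd_adj, cycle_adj_iff hs, pathGraph_adj, Fin.ext_iff, Fin.ext_iff]

/-- half of the symmetric color function -/
def halfCol (s t : ℕ) (h w : ℕ → ℕ → ℕ) (p q : Fin s × Fin t) : ℕ :=
  (if p.2.val = q.2.val ∧ rightOf s p.1 q.1 then h p.1 p.2 else 0) +
  (if p.1.val = q.1.val ∧ p.2.val + 1 = q.2.val then w p.1 p.2 else 0)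

def colOf (s t : ℕ) (h w : ℕ → ℕ → ℕ) : Sym2 (Fin s × Fin t) → ℕ :=
  Sym2.lift ⟨fun p q => halfCol s t h w p q + halfCol s t h w q p, fun _ _ => Nat.add_comm _ _⟩

lemma mem_palette {V : Type*} (G : SimpleGraph V) (f : Sym2 V → ℕ) (v : V) (c : ℕ) :
    c ∈ palette G f v ↔ ∃ u, G.Adj v u ∧ f s(v, u) = c := by
  constructor
  · rintro ⟨e, he, hv, rfl⟩
    obtain ⟨u, rfl⟩ := hv
    exact ⟨u, he, rfl⟩
  · rintro ⟨u, hu, rfl⟩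
    exact ⟨s(v, u), hu, by simp, rfl⟩

/-- color of the edges at a vertex -/
lemma colOf_right {s t : ℕ} (hs : 3 ≤ s) (h w : ℕ → ℕ → ℕ) (p q : Fin s × Fin t)
    (h1 : rightOf s p.1 q.1) (h2 : p.2.val = q.2.val) :
    colOf s t h w s(p, q) = h p.1 p.2 := by
  simp only [colOf, Sym2.lift_mk, halfCol]
  have := p.1.2
  have := q.1.2
  have h3 : ¬ rightOf s q.1 p.1 := by unfold rightOf at *; omega
  simp [h1, h2, h3]

lemma colOf_up {s t : ℕ} (h w : ℕ → ℕ → ℕ) (p q : Fin s × Fin t)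
    (h1 : p.2.val + 1 = q.2.val) (h2 : p.1.val = q.1.val) :
    colOf s t h w s(p, q) = w p.1 p.2 := by
  simp only [colOf, Sym2.lift_mk, halfCol]
  have h3 : ¬ p.2.val = q.2.val := by omega
  have h4 : ¬ q.2.val = p.2.val := by omega
  have h5 : ¬ q.2.val + 1 = p.2.val := by omega
  simp only [h3, h4, h5, h1, h2]
  simp

lemma construct (s t n : ℕ) (hs : 3 ≤ s) (h w : ℕ → ℕ → ℕ) (P : Fin n → Set ℕ)
    (hcond : ∀ i i' j, rightOf s i' i → i < s → i' < s → j < t →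
      h i j ≠ h i' j ∧ (j + 1 < t → w i j ≠ h i j ∧ w i j ≠ h i' j) ∧
      (∀ k, k + 1 = j → w i k ≠ h i j ∧ w i k ≠ h i' j ∧ (j + 1 < t → w i k ≠ w i j)))
    (hK : ∀ i i' j, rightOf s i' i → i < s → i' < s → j < t → ∃ k, ∀ c,
      (c = h i j ∨ c = h i' j ∨ (j + 1 < t ∧ c = w i j) ∨ (0 < j ∧ c = w i (j - 1))) ↔ c ∈ P k) :
    ∃ f, IsProperEdgeColoring (CP s t) f ∧ numPalettes (CP s t) f ≤ n := by
  have hpred : ∀ i, i < s → ∃ i', i' < s ∧ rightOf s i' i := by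
    intro i hi
    by_cases h0 : i = 0
    · exact ⟨s - 1, by omega, by unfold rightOf; omega⟩
    · exact ⟨i - 1, by omega, by unfold rightOf; omega⟩
  have hsucc : ∀ i, i < s → ∃ i', i' < s ∧ rightOf s i i' := by
    intro i hi
    by_cases h0 : i + 1 = s
    · exact ⟨0, by omega, by unfold rightOf; omega⟩
    · exact ⟨i + 1, by omega, by unfold rightOf; omega⟩
  -- classification of the neighbours
  have hcl : ∀ p q : Fin s × Fin t, ∀ i', rightOf s i' p.1 → i' < s → (CP s t).Adj p q →
      (rightOf s p.1 q.1 ∧ q.2.val = p.2.val ∧ colOf s t h w s(p, q) = h p.1 p.2) ∨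
      (q.1.val = i' ∧ q.2.val = p.2.val ∧ colOf s t h w s(p, q) = h i' p.2) ∨
      (q.1.val = p.1.val ∧ q.2.val = p.2.val + 1 ∧ colOf s t h w s(p, q) = w p.1 p.2) ∨
      (q.1.val = p.1.val ∧ q.2.val + 1 = p.2.val ∧ colOf s t h w s(p, q) = w p.1 q.2) := by
    intro p q i' hi' hi's hadj
    rw [CP_adj hs] at hadj
    have hp := p.1.2
    have hq := q.1.2
    rcases hadj with ⟨h1 | h1, h2⟩ | ⟨h1 | h1, h2⟩
    · exact Or.inl ⟨h1, h2.symm, colOf_right hs h w p q h1 h2⟩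
    · refine Or.inr (Or.inl ?_)
      have e : q.1.val = i' := by unfold rightOf at *; omega
      refine ⟨e, h2.symm, ?_⟩
      rw [Sym2.eq_swap, colOf_right hs h w q p h1 h2.symm, e, h2]
    · exact Or.inr (Or.inr (Or.inl ⟨h2.symm, h1.symm, colOf_up h w p q h1 h2⟩))
    · refine Or.inr (Or.inr (Or.inr ⟨h2.symm, h1, ?_⟩))
      rw [Sym2.eq_swap, colOf_up h w q p h1 h2.symm, h2]
  refine ⟨colOf s t h w, ?_, ?_⟩
  · rw [proper_iff]
    intro p a b ha hb hab
    obtain ⟨i', hi's, hi'⟩ := hpred p.1 p.1.2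
    have hc := hcond p.1 i' p.2 hi' p.1.2 hi's p.2.2
    obtain ⟨c1, c2, c3⟩ := hc
    have ha2 := a.2.2
    have hb2 := b.2.2
    have ha1 := a.1.2
    have hb1 := b.1.2
    have hA := hcl p a i' hi' hi's ha
    have hB := hcl p b i' hi' hi's hb
    have goal : a.1.val = b.1.val ∧ a.2.val = b.2.val := by
      have c3a := c3 a.2
      have c3b := c3 b.2
      clear hcl hpred hsucc hK hcond c3 ha hb
      unfold rightOf at *
      rcases hA with ⟨x1, x2, x3⟩ | ⟨x1, x2, x3⟩ | ⟨x1, x2, x3⟩ | ⟨x1, x2, x3⟩ <;>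
      rcases hB with ⟨y1, y2, y3⟩ | ⟨y1, y2, y3⟩ | ⟨y1, y2, y3⟩ | ⟨y1, y2, y3⟩ <;>
      rw [x3, y3] at hab <;> grind
    exact Prod.ext (Fin.ext goal.1) (Fin.ext goal.2)
  · unfold numPalettes
    have hsub : Set.range (palette (CP s t) (colOf s t h w)) ⊆ Set.range P := by
      rintro _ ⟨p, rfl⟩
      obtain ⟨i', hi's, hi'⟩ := hpred p.1 p.1.2
      obtain ⟨i2, hi2s, hi2⟩ := hsucc p.1 p.1.2
      obtain ⟨k, hk⟩ := hK p.1 i' p.2 hi' p.1.2 hi's p.2.2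
      refine ⟨k, ?_⟩
      ext c
      rw [← hk, mem_palette]
      constructor
      · rintro (rfl | rfl | ⟨hj, rfl⟩ | ⟨hj, rfl⟩)
        · exact ⟨(⟨i2, hi2s⟩, p.2), by rw [CP_adj hs]; simp [hi2], colOf_right hs h w _ _ hi2 rfl⟩
        · refine ⟨(⟨i', hi's⟩, p.2), by rw [CP_adj hs]; simp [hi'], ?_⟩
          rw [Sym2.eq_swap]
          exact colOf_right hs h w (⟨i', hi's⟩, p.2) p hi' rfl
        · exact ⟨(p.1, ⟨p.2 + 1, hj⟩), by rw [CP_adj hs]; simp, colOf_up h w _ _ rfl rfl⟩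
        · have hj' : p.2.val - 1 + 1 = p.2.val := by omega
          have hlt := p.2.2
          refine ⟨(p.1, ⟨p.2 - 1, by omega⟩), by rw [CP_adj hs]; simp [hj'], ?_⟩
          rw [Sym2.eq_swap]
          exact colOf_up h w (p.1, ⟨p.2 - 1, by omega⟩) p hj' rfl
      · rintro ⟨q, hq, rfl⟩
        have := q.2.2
        rcases hcl p q i' hi' hi's hq with ⟨x1, x2, x3⟩ | ⟨x1, x2, x3⟩ | ⟨x1, x2, x3⟩ | ⟨x1, x2, x3⟩
        · exact Or.inl x3
        · exact Or.inr (Or.inl x3)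
        · exact Or.inr (Or.inr (Or.inl ⟨by omega, x3⟩))
        · refine Or.inr (Or.inr (Or.inr ⟨by omega, ?_⟩))
          rw [x3, ← x2]; simp
    calc _ ≤ (Set.range P).ncard := Set.ncard_le_ncard hsub (Set.finite_range P)
      _ ≤ n := by
        rw [← Set.image_univ]
        refine (Set.ncard_image_le Set.finite_univ).trans ?_
        simp [Set.ncard_univ]

lemma upper_even (s t : ℕ) (hs : 3 ≤ s) (ht : 3 ≤ t) (he : s % 2 = 0) :
    ∃ f, IsProperEdgeColoring (CP s t) f ∧ numPalettes (CP s t) f ≤ 2 := by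
  refine construct s t 2 hs
    (fun i j => if i % 2 = 0 then 2 else if j = 0 then 1 else if j + 1 = t then 1 - t % 2 else 3)
    (fun _ j => j % 2) ![{c | c < 3}, {c | c < 4}] ?_ ?_
  · intro i i' j hr hi hi' hj
    unfold rightOf at hr
    refine ⟨?_, ?_, ?_⟩
    · split_ifs <;> omega
    · intro h; split_ifs <;> omega
    · intro k hk; split_ifs <;> omega
  · intro i i' j hr hi hi' hj
    unfold rightOf at hr
    by_cases hb : j = 0 ∨ j + 1 = t
    · refine ⟨0, fun c => ?_⟩
      simp only [Matrix.cons_val_zero, Set.mem_ofPred_eq]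
      split_ifs <;> omega
    · refine ⟨1, fun c => ?_⟩
      simp only [Matrix.cons_val_one, Matrix.cons_val_fin_one, Set.mem_ofPred_eq]
      split_ifs <;> omega

lemma upper_odd_even (s t : ℕ) (hs : 3 ≤ s) (ht : 3 ≤ t) (he : s % 2 = 1) (ht2 : t % 2 = 0) :
    ∃ f, IsProperEdgeColoring (CP s t) f ∧ numPalettes (CP s t) f ≤ 2 := by
  refine construct s t 2 hs
    (fun i _ => if i + 1 = s then 2 else i % 2)
    (fun i j => if j % 2 = 1 then 3 else if i = 0 then 1 else if i + 1 = s then 0 else 2)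
    ![{c | c < 3}, {c | c < 4}] ?_ ?_
  · intro i i' j hr hi hi' hj
    unfold rightOf at hr
    refine ⟨?_, ?_, ?_⟩
    · split_ifs <;> omega
    · intro h; split_ifs <;> omega
    · intro k hk; split_ifs <;> omega
  · intro i i' j hr hi hi' hj
    unfold rightOf at hr
    by_cases hb : j = 0 ∨ j + 1 = t
    · refine ⟨0, fun c => ?_⟩
      simp only [Matrix.cons_val_zero, Set.mem_ofPred_eq]
      split_ifs <;> omega
    · refine ⟨1, fun c => ?_⟩
      simp only [Matrix.cons_val_one, Matrix.cons_val_fin_one, Set.mem_ofPred_eq]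
      split_ifs <;> omega

set_option maxHeartbeats 1000000 in
lemma upper_odd_odd (s t : ℕ) (hs : 3 ≤ s) (ht : 3 ≤ t) (he : s % 2 = 1) (ht2 : t % 2 = 1) :
    ∃ f, IsProperEdgeColoring (CP s t) f ∧ numPalettes (CP s t) f ≤ 4 := by
  refine construct s t 4 hs
    (fun i j => if j = 0 then (if i + 1 = s then 4 else if i % 2 = 0 then 2 else 0)
      else if j = 1 then (if i + 1 = s then 2 else if i % 2 = 1 then 3 else 0)
      else (if i + 1 = s then 2 else i % 2))
    (fun i j => if j = 0 then (if i = 0 then 3 else 1)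
      else if j % 2 = 0 then 3 else if i = 0 then 1 else if i + 1 = s then 0 else 2)
    ![{c | c < 3}, {c | c < 4}, {c | 2 ≤ c ∧ c < 5}, {c | c < 2 ∨ c = 4}] ?_ ?_
  · intro i i' j hr hi hi' hj
    unfold rightOf at hr
    refine ⟨?_, ?_, ?_⟩
    · split_ifs <;> omega
    · intro h; split_ifs <;> omega
    · intro k hk; subst hk; split_ifs <;> first | contradiction | omega
  · intro i i' j hr hi hi' hj
    unfold rightOf at hr
    by_cases hb : j = 0
    · subst hb
      by_cases h0 : i = 0
      · refine ⟨2, fun c => ?_⟩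
        simp [h0]
        split_ifs <;> omega
      · by_cases h1 : i + 1 = s
        · refine ⟨3, fun c => ?_⟩
          simp [h0, h1]
          split_ifs <;> omega
        · refine ⟨0, fun c => ?_⟩
          simp [h0, h1]
          split_ifs <;> omega
    · by_cases hbt : j + 1 = t
      · refine ⟨0, fun c => ?_⟩
        simp only [Matrix.cons_val_zero, Set.mem_ofPred_eq]
        split_ifs <;> omega
      · refine ⟨1, fun c => ?_⟩
        by_cases hj1 : j = 1
        · subst hj1
          simp [show 1 + 1 < t by omega]
          split_ifs <;> omega
        · have e1 : j - 1 ≠ 0 := by omega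
          have e2 : j + 1 < t := by omega
          have e3 : 0 < j := by omega
          simp only [Matrix.cons_val_one, Matrix.cons_val_zero, Set.mem_ofPred_eq, hb, hj1, e1, e2, e3,
            if_false, true_and]
          rcases Nat.mod_two_eq_zero_or_one j with e4 | e4
          · have e5 : (j - 1) % 2 ≠ 0 := by omega
            simp only [e4, e5, if_true, if_false]
            split_ifs <;> omega
          · have e5 : (j - 1) % 2 = 0 := by omega
            simp only [e4, e5, if_true, one_ne_zero, if_false]
            split_ifs <;> omega

lemma even_of_color {V : Type*} [DecidableEq V] (G : SimpleGraph V) (f : Sym2 V → ℕ)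
    (hf : IsProperEdgeColoring G f) (c : ℕ) (S : Finset V)
    (hS : ∀ v ∈ S, ∃ u ∈ S, G.Adj v u ∧ f s(v, u) = c) : Even S.card := by
  rw [proper_iff] at hf
  choose g hg1 hg2 hg3 using hS
  have : ∑ v ∈ S, (1 : ZMod 2) = 0 := by
    refine Finset.sum_involution g (fun _ _ => by decide) ?_ hg1 ?_
    · intro a ha _ h
      exact (hg2 a ha).ne h.symm
    · intro a ha
      refine hf (g a ha) _ _ (hg2 _ _) (hg2 a ha).symm ?_
      rw [hg3, Sym2.eq_swap, hg3]
  rw [Finset.sum_const, nsmul_one] at this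
  exact (ZMod.natCast_eq_zero_iff_even).mp this

lemma even_count {V : Type*} [Fintype V] [DecidableEq V] (G : SimpleGraph V) (f : Sym2 V → ℕ)
    (hf : IsProperEdgeColoring G f) (c : ℕ) [DecidablePred fun v => c ∈ palette G f v] :
    Even (Finset.univ.filter fun v => c ∈ palette G f v).card := by
  refine even_of_color G f hf c _ ?_
  intro v hv
  simp only [Finset.mem_filter, Finset.mem_univ, true_and] at hv ⊢
  obtain ⟨u, hu, huc⟩ := (mem_palette _ _ _ _).mp hv
  exact ⟨u, (mem_palette _ _ _ _).mpr ⟨v, hu.symm, by rw [Sym2.eq_swap, huc]⟩, hu, huc⟩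

lemma cycle_nbr {s : ℕ} (hs : 3 ≤ s) (a : Fin s) : ((cycleGraph s).neighborFinset a).card = 2 := by
  obtain ⟨n, rfl⟩ : ∃ n, s = n + 3 := ⟨s - 3, by omega⟩
  exact cycleGraph_degree_three_le (n := n) (v := a)

lemma degree_CP {s t : ℕ} (hs : 3 ≤ s) (v : Fin s × Fin t) :
    ((CP s t).neighborSet v).ncard = 2 + ((pathGraph t).neighborSet v.2).ncard := by
  classical
  rw [Set.ncard_eq_toFinset_card', Set.ncard_eq_toFinset_card']
  have h1 := degree_boxProd (G := cycleGraph s) (H := pathGraph t) v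
  have h2 := cycle_nbr hs v.1
  change (cycleGraph s).degree v.1 = 2 at h2
  rw [← h2]
  convert h1 <;> (unfold SimpleGraph.degree SimpleGraph.neighborFinset; congr!)

lemma path_nbr_bd {t : ℕ} (ht : 3 ≤ t) (j : Fin t) (hj : j.val = 0 ∨ j.val + 1 = t) :
    ((pathGraph t).neighborSet j).ncard = 1 := by
  rw [Set.ncard_eq_one]
  rcases hj with hj | hj
  · refine ⟨⟨1, by omega⟩, ?_⟩
    ext k
    rw [mem_neighborSet, pathGraph_adj, Set.mem_singleton_iff, Fin.ext_iff]
    simp only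
    omega
  · refine ⟨⟨t - 2, by omega⟩, ?_⟩
    ext k
    have := k.2
    rw [mem_neighborSet, pathGraph_adj, Set.mem_singleton_iff, Fin.ext_iff]
    simp only
    omega

lemma path_nbr_in {t : ℕ} (j : Fin t) (hj : ¬ (j.val = 0 ∨ j.val + 1 = t)) :
    ((pathGraph t).neighborSet j).ncard = 2 := by
  have hlt := j.2
  rw [Set.ncard_eq_two]
  refine ⟨⟨j - 1, by omega⟩, ⟨j + 1, by omega⟩, ?_, ?_⟩
  · rw [Ne, Fin.ext_iff]; simp only; omega
  · ext k
    have := k.2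
    rw [mem_neighborSet, pathGraph_adj, Set.mem_insert_iff, Set.mem_singleton_iff, Fin.ext_iff,
      Fin.ext_iff]
    simp only
    omega

lemma pal_bd {s t : ℕ} (hs : 3 ≤ s) (ht : 3 ≤ t) (f) (hf : IsProperEdgeColoring (CP s t) f)
    (v : Fin s × Fin t) (hv : v.2.val = 0 ∨ v.2.val + 1 = t) :
    (palette (CP s t) f v).ncard = 3 := by
  rw [palette_ncard _ _ hf, degree_CP hs, path_nbr_bd ht _ hv]

lemma pal_in {s t : ℕ} (hs : 3 ≤ s) (f) (hf : IsProperEdgeColoring (CP s t) f)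
    (v : Fin s × Fin t) (hv : ¬ (v.2.val = 0 ∨ v.2.val + 1 = t)) :
    (palette (CP s t) f v).ncard = 4 := by
  rw [palette_ncard _ _ hf, degree_CP hs, path_nbr_in _ hv]

lemma lower_two {s t : ℕ} (hs : 3 ≤ s) (ht : 3 ≤ t) (f) (hf : IsProperEdgeColoring (CP s t) f) :
    2 ≤ numPalettes (CP s t) f := by
  unfold numPalettes
  have h1 := pal_bd hs ht f hf (⟨0, by omega⟩, ⟨0, by omega⟩) (by simp)
  have h2 := pal_in hs f hf (⟨0, by omega⟩, ⟨1, by omega⟩) (by simp; omega)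
  rw [← Set.ncard_pair (a := palette (CP s t) f (⟨0, by omega⟩, ⟨0, by omega⟩))
    (b := palette (CP s t) f (⟨0, by omega⟩, ⟨1, by omega⟩)) (fun e => by rw [e] at h1; omega)]
  refine Set.ncard_le_ncard ?_ (Set.finite_range _)
  rintro _ (rfl | rfl) <;> exact Set.mem_range_self _

lemma le_two_cover {α : Type*} [DecidableEq α] (S : Finset α) (hne : S.Nonempty) (h : S.card ≤ 2) :
    ∃ a b, ∀ x ∈ S, x = a ∨ x = b := by
  have := hne.card_pos
  rcases (show S.card = 1 ∨ S.card = 2 by omega) with h | h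
  · obtain ⟨a, rfl⟩ := Finset.card_eq_one.mp h
    exact ⟨a, a, by simp⟩
  · obtain ⟨a, b, -, rfl⟩ := Finset.card_eq_two.mp h
    exact ⟨a, b, by simp⟩

open Classical in
lemma count_const {V : Type*} (p : V → Set ℕ) (S : Finset V) (P : Set ℕ)
    (h : ∀ v ∈ S, p v = P) (c : ℕ) :
    (S.filter fun v => c ∈ p v).card = if c ∈ P then S.card else 0 := by
  split_ifs with hc
  · rw [Finset.filter_true_of_mem]
    intro v hv; rw [h v hv]; exact hc
  · rw [Finset.filter_false_of_mem, Finset.card_empty]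
    intro v hv; rw [h v hv]; exact hc

open Classical in
lemma count_two {V : Type*} (p : V → Set ℕ) (S : Finset V) (P Q : Set ℕ)
    (h : ∀ v ∈ S, p v = P ∨ p v = Q) (c : ℕ) :
    (S.filter fun v => c ∈ p v).card = (if c ∈ P then (S.filter fun v => p v = P).card else 0) +
      (if c ∈ Q then (S.filter fun v => ¬ p v = P).card else 0) := by
  rw [← count_const p (S.filter fun v => p v = P) P (by simp),
    ← count_const p (S.filter fun v => ¬ p v = P) Q (by
      intro v hv
      rw [Finset.mem_filter] at hv
      exact (h v hv.1).resolve_left hv.2)]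
  rw [← Finset.card_filter_add_card_filter_not (s := S.filter fun v => c ∈ p v) (fun v => p v = P)]
  congr 2 <;> ext v <;> simp only [Finset.mem_filter] <;> tauto

open Classical in
lemma lower_four {s t : ℕ} (hs : 3 ≤ s) (ht : 3 ≤ t) (hso : s % 2 = 1) (hto : t % 2 = 1) (f)
    (hf : IsProperEdgeColoring (CP s t) f) : 4 ≤ numPalettes (CP s t) f := by
  by_contra hlt
  set p := palette (CP s t) f with hp
  let T : Finset (Fin t) := {⟨0, by omega⟩, ⟨t - 1, by omega⟩}
  have hT : T.card = 2 := by
    refine Finset.card_pair ?_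
    rw [Ne, Fin.ext_iff]; simp only; omega
  have hmT : ∀ j : Fin t, j ∈ T ↔ (j.val = 0 ∨ j.val + 1 = t) := by
    intro j
    simp only [T, Finset.mem_insert, Finset.mem_singleton, Fin.ext_iff]
    omega
  let B : Finset (Fin s × Fin t) := Finset.univ ×ˢ T
  let I : Finset (Fin s × Fin t) := Finset.univ ×ˢ Tᶜ
  have hmB : ∀ v, v ∈ B ↔ (v.2.val = 0 ∨ v.2.val + 1 = t) := by
    intro v; simp only [B, Finset.mem_product, Finset.mem_univ, true_and, hmT]
  have hmI : ∀ v, v ∈ I ↔ ¬ (v.2.val = 0 ∨ v.2.val + 1 = t) := by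
    intro v; simp only [I, Finset.mem_product, Finset.mem_univ, true_and, Finset.mem_compl, hmT]
  have hBc : B.card % 2 = 0 := by
    simp [B, Finset.card_product, hT]
  have hIc : I.card % 2 = 1 := by
    simp only [I, Finset.card_product, Finset.card_compl, hT, Finset.card_univ, Fintype.card_fin]
    rw [Nat.mul_mod, hso, show (t - 2) % 2 = 1 by omega]
  have hdis : Disjoint B I := by
    rw [Finset.disjoint_left]; intro v hb hi
    exact (hmI v).mp hi ((hmB v).mp hb)
  have hun : B ∪ I = Finset.univ := by
    ext v; simp only [Finset.mem_union, hmB, hmI, Finset.mem_univ, iff_true]; tauto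
  have hcount : ∀ c, ((B.filter fun v => c ∈ p v).card + (I.filter fun v => c ∈ p v).card) % 2 = 0 := by
    intro c
    have := even_count _ f hf c
    rw [← hun, Finset.filter_union, Finset.card_union_of_disjoint
      (Finset.disjoint_filter_filter hdis)] at this
    exact Nat.even_iff.mp this
  have hB3 : ∀ v ∈ B, (p v).ncard = 3 := fun v hv => pal_bd hs ht f hf v ((hmB v).mp hv)
  have hI4 : ∀ v ∈ I, (p v).ncard = 4 := fun v hv => pal_in hs f hf v ((hmI v).mp hv)
  have hBne : (B.image p).Nonempty := by
    refine Finset.Nonempty.image ⟨(⟨0, by omega⟩, ⟨0, by omega⟩), ?_⟩ p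
    rw [hmB]; simp
  have hIne : (I.image p).Nonempty := by
    refine Finset.Nonempty.image ⟨(⟨0, by omega⟩, ⟨1, by omega⟩), ?_⟩ p
    rw [hmI]; simp; omega
  have hsum : (B.image p).card + (I.image p).card ≤ 3 := by
    rw [← Finset.card_union_of_disjoint, ← Finset.image_union, hun]
    · unfold numPalettes at hlt
      rw [← hp, Set.ncard_eq_toFinset_card', Set.toFinset_range] at hlt
      have : (Finset.univ.image p).card < 4 := by convert not_le.mp hlt
      omega
    · rw [Finset.disjoint_left]
      intro x hx hy
      obtain ⟨v, hv, rfl⟩ := Finset.mem_image.mp hx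
      obtain ⟨u, hu, he⟩ := Finset.mem_image.mp hy
      have h1 := hB3 v hv
      have h2 := hI4 u hu
      rw [he] at h2; omega
  have hb1 := hBne.card_pos
  have hi1 := hIne.card_pos
  obtain ⟨P1, P2, hP⟩ := le_two_cover _ hBne (by omega)
  obtain ⟨Q1, Q2, hQ⟩ := le_two_cover _ hIne (by omega)
  have hP' : ∀ v ∈ B, p v = P1 ∨ p v = P2 := fun v hv => hP _ (Finset.mem_image_of_mem _ hv)
  have hQ' : ∀ v ∈ I, p v = Q1 ∨ p v = Q2 := fun v hv => hQ _ (Finset.mem_image_of_mem _ hv)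
  have hne : ∀ v ∈ I, ∃ c, c ∈ p v := by
    intro v hv
    refine Set.nonempty_of_ncard_ne_zero ?_
    rw [hI4 v hv]; norm_num
  rcases (show (B.image p).card = 1 ∨ (I.image p).card = 1 by omega) with hc | hc
  · -- a single boundary palette
    obtain ⟨P, hPe⟩ := Finset.card_eq_one.mp hc
    have hPB : ∀ v ∈ B, p v = P := fun v hv => by
      have := Finset.mem_image_of_mem p hv
      rwa [hPe, Finset.mem_singleton] at this
    have hev : ∀ c, (I.filter fun v => c ∈ p v).card % 2 = 0 := by
      intro c
      have h1 := hcount c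
      rw [count_const p B P hPB] at h1
      split_ifs at h1 <;> omega
    have hs2 := Finset.card_filter_add_card_filter_not (s := I) (fun v => p v = Q1)
    rcases Nat.mod_two_eq_zero_or_one (I.filter fun v => p v = Q1).card with hm | hm
    · have hpos : 0 < (I.filter fun v => ¬ p v = Q1).card := by omega
      obtain ⟨v, hv⟩ := Finset.card_pos.mp hpos
      rw [Finset.mem_filter] at hv
      obtain ⟨c, hc⟩ := hne v hv.1
      rw [(hQ' v hv.1).resolve_left hv.2] at hc
      have h1 := hev c
      rw [count_two p I Q1 Q2 hQ', if_pos hc] at h1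
      split_ifs at h1 <;> omega
    · have hpos : 0 < (I.filter fun v => p v = Q1).card := by omega
      obtain ⟨v, hv⟩ := Finset.card_pos.mp hpos
      rw [Finset.mem_filter] at hv
      obtain ⟨c, hc⟩ := hne v hv.1
      rw [hv.2] at hc
      have h1 := hev c
      rw [count_two p I Q1 Q2 hQ', if_pos hc] at h1
      split_ifs at h1 <;> omega
  · -- a single interior palette
    obtain ⟨Q, hQe⟩ := Finset.card_eq_one.mp hc
    have hQI : ∀ v ∈ I, p v = Q := fun v hv => by
      have := Finset.mem_image_of_mem p hv
      rwa [hQe, Finset.mem_singleton] at this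
    have hc2 : ∀ c, ((if c ∈ P1 then (B.filter fun v => p v = P1).card else 0) +
        (if c ∈ P2 then (B.filter fun v => ¬ p v = P1).card else 0) +
        (if c ∈ Q then I.card else 0)) % 2 = 0 := by
      intro c
      rw [← count_two p B P1 P2 hP', ← count_const p I Q hQI]
      exact hcount c
    have hs2 := Finset.card_filter_add_card_filter_not (s := B) (fun v => p v = P1)
    obtain ⟨v0, hv0⟩ : ∃ v, v ∈ I := by
      obtain ⟨x, hx⟩ := hIne
      obtain ⟨v, hv, -⟩ := Finset.mem_image.mp hx
      exact ⟨v, hv⟩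
    have hQ4 : Q.ncard = 4 := by rw [← hQI v0 hv0]; exact hI4 v0 hv0
    have hodd1 : (B.filter fun v => p v = P1).card % 2 = 1 := by
      obtain ⟨c, hc⟩ := hne v0 hv0
      rw [hQI v0 hv0] at hc
      have := hc2 c
      rw [if_pos hc] at this
      split_ifs at this <;> omega
    have hodd2 : (B.filter fun v => ¬ p v = P1).card % 2 = 1 := by omega
    have hP13 : P1.ncard = 3 := by
      obtain ⟨v, hv⟩ := Finset.card_pos.mp (show 0 < (B.filter fun v => p v = P1).card by omega)
      rw [Finset.mem_filter] at hv
      rw [← hv.2]; exact hB3 v hv.1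
    have hP23 : P2.ncard = 3 := by
      obtain ⟨v, hv⟩ := Finset.card_pos.mp (show 0 < (B.filter fun v => ¬ p v = P1).card by omega)
      rw [Finset.mem_filter] at hv
      rw [← (hP' v hv.1).resolve_left hv.2]; exact hB3 v hv.1
    have hiff : ∀ c, c ∉ Q ↔ (c ∈ P1 ↔ c ∈ P2) := by
      intro c
      have := hc2 c
      by_cases a1 : c ∈ P1 <;> by_cases a2 : c ∈ P2 <;> by_cases a3 : c ∈ Q <;>
        simp only [a1, a2, a3, if_true, if_false] at this ⊢ <;> first | omega | simp
    have hfin : ∀ S : Set ℕ, S.ncard ≠ 0 → S.Finite := fun S h => Set.finite_of_ncard_ne_zero h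
    obtain ⟨x, hx1, hx2⟩ : ∃ x, x ∈ P1 ∧ x ∈ P2 := by
      by_contra hcon
      push Not at hcon
      have hd : Disjoint P1 P2 := Set.disjoint_left.mpr hcon
      have hsub : P1 ∪ P2 ⊆ Q := by
        intro c hc
        by_contra hcQ
        have h1 := (hiff c).mp hcQ
        have h2 := hcon c
        rcases hc with hc | hc <;> tauto
      have h1 := Set.ncard_le_ncard hsub (hfin Q (by omega))
      rw [Set.ncard_union_eq hd (hfin _ (by omega)) (hfin _ (by omega))] at h1
      omega
    have hxQ : x ∉ Q := (hiff x).mpr (by tauto)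
    have hev := even_of_color (CP s t) f hf x (Finset.univ ×ˢ {⟨0, by omega⟩}) (by
      intro v hv
      have hv0 : v.2.val = 0 := by
        simp only [Finset.mem_product, Finset.mem_univ, true_and, Finset.mem_singleton,
          Fin.ext_iff] at hv
        exact hv
      have hxv : x ∈ p v := by
        rcases hP' v ((hmB v).mpr (Or.inl hv0)) with h | h <;> rw [h] <;> assumption
      obtain ⟨u, hu, hc⟩ := (mem_palette _ _ _ _).mp hxv
      refine ⟨u, ?_, hu, hc⟩
      have hxu : x ∈ p u := (mem_palette _ _ _ _).mpr ⟨v, hu.symm, by rw [Sym2.eq_swap, hc]⟩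
      have huI : u ∉ I := fun h => hxQ (by rw [← hQI u h]; exact hxu)
      rw [hmI, not_not] at huI
      rw [CP_adj hs] at hu
      simp only [Finset.mem_product, Finset.mem_univ, true_and, Finset.mem_singleton, Fin.ext_iff]
      omega)
    rw [Finset.card_product, Finset.card_univ, Fintype.card_fin, Finset.card_singleton, mul_one,
      Nat.even_iff] at hev
    omega

lemma index_eq {s t n : ℕ} (h1 : ∃ f, IsProperEdgeColoring (CP s t) f ∧ numPalettes (CP s t) f ≤ n)
    (h2 : ∀ f, IsProperEdgeColoring (CP s t) f → n ≤ numPalettes (CP s t) f) :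
    paletteIndex (CP s t) = n := by
  obtain ⟨f, hf, hn⟩ := h1
  have e : numPalettes (CP s t) f = n := le_antisymm hn (h2 f hf)
  refine le_antisymm (Nat.sInf_le ⟨f, hf, e⟩) (le_csInf ⟨n, f, hf, e⟩ ?_)
  rintro m ⟨g, hg, rfl⟩
  exact h2 g hg

/-- For `s, t ≥ 3`, `š(C_s □ P_t) = 4` if `s` and `t` are both odd,
and `š(C_s □ P_t) = 2` otherwise. -/
theorem paletteIndex_cycle_boxProd_path (s t : ℕ) (hs : 3 ≤ s) (ht : 3 ≤ t) :
    (Odd s ∧ Odd t → paletteIndex (cycleGraph s □ pathGraph t) = 4) ∧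
    (¬(Odd s ∧ Odd t) → paletteIndex (cycleGraph s □ pathGraph t) = 2) := by
  rw [Nat.odd_iff, Nat.odd_iff]
  constructor
  · rintro ⟨h1, h2⟩
    exact index_eq (upper_odd_odd s t hs ht h1 h2) (fun f hf => lower_four hs ht h1 h2 f hf)
  · intro h
    refine index_eq ?_ (fun f hf => lower_two hs ht f hf)
    rcases Nat.mod_two_eq_zero_or_one s with h1 | h1
    · exact upper_even s t hs ht h1
    · exact upper_odd_even s t hs ht h1 (by omega)
end

section
/- Let s ≥ t ≥ 3 be odd integers. Then the Cartesian product C_s □ C_t admits an even cycle decomposition of size 3; that is, the edge set of C_s □ C_t can be partitioned into three classes such that the edges of each class form a disjoint union of cycles of even length. -/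
open SimpleGraph

/-- A finite graph is a disjoint union of even cycles: every vertex has degree
`0` or `2`, and the graph is bipartite (equivalently, since all nontrivial
components are cycles, every such cycle has even length). -/
def IsDisjointUnionOfEvenCycles {V : Type*} [Fintype V] (G : SimpleGraph V) : Prop :=
  (∀ v, vertDegree G v = 0 ∨ vertDegree G v = 2) ∧ G.Colorable 2

namespace ECD

/-- The edge class of color `c`, from the colors of horizontal and vertical edges. -/
def cls {n m : ℕ} (h v : Fin (n+3) → Fin (m+3) → Fin 3) (c : Fin 3) :
    Set (Sym2 (Fin (n+3) × Fin (m+3))) :=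
  {e | ∃ i j, (h i j = c ∧ e = s((i,j),(i+1,j))) ∨ (v i j = c ∧ e = s((i,j),(i,j+1)))}

lemma one_ne (n : ℕ) : (1 : Fin (n+3)) ≠ 0 := by
  simp [Fin.ext_iff]

lemma two_ne (n : ℕ) : (1 + 1 : Fin (n+3)) ≠ 0 := by
  intro h
  have h1 := congrArg Fin.val h
  rw [Fin.val_add] at h1
  simp at h1
  have := Nat.mod_eq_of_lt (show 2 < n + 3 by omega)
  omega

lemma add_one_ne {n : ℕ} (i : Fin (n+3)) : i + 1 ≠ i := by
  simp

lemma add_two_ne {n : ℕ} (i : Fin (n+3)) : i + 1 + 1 ≠ i := by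
  rw [add_assoc]
  intro h
  exact two_ne n (by simpa using h)

lemma mem_cls {n m : ℕ} (h v : Fin (n+3) → Fin (m+3) → Fin 3) (c : Fin 3)
    (i : Fin (n+3)) (j : Fin (m+3)) (x : Fin (n+3) × Fin (m+3)) :
    s((i+1,j+1),x) ∈ cls h v c ↔
      (h (i+1) (j+1) = c ∧ x = (i+1+1,j+1)) ∨ (h i (j+1) = c ∧ x = (i,j+1)) ∨
      (v (i+1) (j+1) = c ∧ x = (i+1,j+1+1)) ∨ (v (i+1) j = c ∧ x = (i+1,j)) := by
  obtain ⟨x1, x2⟩ := x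
  simp only [cls, Set.mem_ofPred_eq, Sym2.eq_iff, Prod.mk.injEq]
  constructor
  · rintro ⟨a, b, (⟨hc, (⟨⟨rfl, rfl⟩, rfl, rfl⟩ | ⟨⟨h1, rfl⟩, rfl, rfl⟩)⟩ |
      ⟨hc, (⟨⟨rfl, rfl⟩, rfl, rfl⟩ | ⟨⟨rfl, h1⟩, rfl, rfl⟩)⟩)⟩
    · exact Or.inl ⟨hc, rfl, rfl⟩
    · obtain rfl := add_right_cancel h1
      exact Or.inr (Or.inl ⟨hc, rfl, rfl⟩)
    · exact Or.inr (Or.inr (Or.inl ⟨hc, rfl, rfl⟩))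
    · obtain rfl := add_right_cancel h1
      exact Or.inr (Or.inr (Or.inr ⟨hc, rfl, rfl⟩))
  · rintro (⟨hc, rfl, rfl⟩ | ⟨hc, rfl, rfl⟩ | ⟨hc, rfl, rfl⟩ | ⟨hc, rfl, rfl⟩)
    · exact ⟨_, _, Or.inl ⟨hc, Or.inl ⟨⟨rfl, rfl⟩, rfl, rfl⟩⟩⟩
    · exact ⟨_, _, Or.inl ⟨hc, Or.inr ⟨⟨rfl, rfl⟩, rfl, rfl⟩⟩⟩
    · exact ⟨_, _, Or.inr ⟨hc, Or.inl ⟨⟨rfl, rfl⟩, rfl, rfl⟩⟩⟩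
    · exact ⟨_, _, Or.inr ⟨hc, Or.inr ⟨⟨rfl, rfl⟩, rfl, rfl⟩⟩⟩

/-- The local degree condition at a vertex. -/
def deg (a b c d k : Fin 3) : Prop :=
  ((if a = k then 1 else 0) + (if b = k then 1 else 0) + (if c = k then 1 else 0) +
    (if d = k then 1 else 0) : ℕ) ∈ ({0, 2} : Finset ℕ)

instance (a b c d k : Fin 3) : Decidable (deg a b c d k) := by
  unfold deg; infer_instance

lemma main {n m : ℕ} (h v : Fin (n+3) → Fin (m+3) → Fin 3)
    (p : Fin 3 → Fin (n+3) → Fin (m+3) → Bool)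
    (hne : ∀ c, ∃ i j, h i j = c)
    (hd : ∀ i j c, deg (h (i+1) (j+1)) (h i (j+1)) (v (i+1) (j+1)) (v (i+1) j) c)
    (hh : ∀ i j, p (h i j) i j ≠ p (h i j) (i+1) j)
    (hv : ∀ i j, p (v i j) i j ≠ p (v i j) i (j+1)) :
    ∃ E : Fin 3 → Set (Sym2 (Fin (n+3) × Fin (m+3))),
      (∀ i, (E i).Nonempty) ∧
      (∀ i, E i ⊆ (cycleGraph (n+3) □ cycleGraph (m+3)).edgeSet) ∧
      (⋃ i, E i) = (cycleGraph (n+3) □ cycleGraph (m+3)).edgeSet ∧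
      (∀ i j, i ≠ j → Disjoint (E i) (E j)) ∧
      (∀ i, IsDisjointUnionOfEvenCycles (SimpleGraph.fromEdgeSet (E i))) := by
  have hsub : ∀ i, cls h v i ⊆ (cycleGraph (n+3) □ cycleGraph (m+3)).edgeSet := by
    rintro c e ⟨i, j, (⟨hc, rfl⟩ | ⟨hc, rfl⟩)⟩
    · simp [boxProd_adj, cycleGraph_adj]
    · simp [boxProd_adj, cycleGraph_adj]
  refine ⟨cls h v, ?_, hsub, ?_, ?_, ?_⟩
  · intro c
    obtain ⟨i, j, hc⟩ := hne c
    exact ⟨_, i, j, Or.inl ⟨hc, rfl⟩⟩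
  · refine Set.Subset.antisymm (Set.iUnion_subset hsub) ?_
    intro e he
    rw [Set.mem_iUnion]
    induction e using Sym2.ind with
    | _ x y =>
    obtain ⟨i, j⟩ := x
    obtain ⟨a, b⟩ := y
    simp only [mem_edgeSet, boxProd_adj, cycleGraph_adj] at he
    rcases he with ⟨h1 | h1, h2⟩ | ⟨h1 | h1, h2⟩
    · obtain rfl : i = a + 1 := by rw [← h1]; abel
      obtain rfl := h2
      exact ⟨_, a, j, Or.inl ⟨rfl, Sym2.eq_swap⟩⟩
    · obtain rfl : a = i + 1 := by rw [← h1]; abel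
      obtain rfl := h2
      exact ⟨_, i, j, Or.inl ⟨rfl, rfl⟩⟩
    · obtain rfl : j = b + 1 := by rw [← h1]; abel
      obtain rfl := h2
      exact ⟨_, i, b, Or.inr ⟨rfl, Sym2.eq_swap⟩⟩
    · obtain rfl : b = j + 1 := by rw [← h1]; abel
      obtain rfl := h2
      exact ⟨_, i, j, Or.inr ⟨rfl, rfl⟩⟩
  · intro c d hcd
    rw [Set.disjoint_left]
    intro e
    induction e using Sym2.ind with
    | _ x y =>
    obtain ⟨i, j⟩ := x
    obtain ⟨i, rfl⟩ : ∃ k, i = k + 1 := ⟨i - 1, by abel⟩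
    obtain ⟨j, rfl⟩ : ∃ k, j = k + 1 := ⟨j - 1, by abel⟩
    rw [mem_cls, mem_cls]
    have i1 := add_one_ne i
    have j1 := add_one_ne j
    have i2 := add_two_ne i
    have j2 := add_two_ne j
    have i3 := add_one_ne (i+1)
    have j3 := add_one_ne (j+1)
    rintro (⟨hc, rfl⟩ | ⟨hc, rfl⟩ | ⟨hc, rfl⟩ | ⟨hc, rfl⟩) (⟨hcq, hx⟩ | ⟨hcq, hx⟩ | ⟨hcq, hx⟩ | ⟨hcq, hx⟩) <;>
      simp only [Prod.mk.injEq] at hx <;> grind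
  · intro c
    constructor
    · rintro ⟨i, j⟩
      obtain ⟨i, rfl⟩ : ∃ k, i = k + 1 := ⟨i - 1, by abel⟩
      obtain ⟨j, rfl⟩ : ∃ k, j = k + 1 := ⟨j - 1, by abel⟩
      have i1 := add_one_ne i
      have j1 := add_one_ne j
      have i2 := add_two_ne i
      have j2 := add_two_ne j
      have i3 := add_one_ne (i+1)
      have j3 := add_one_ne (j+1)
      have key : (fromEdgeSet (cls h v c)).neighborSet (i+1,j+1) =
          ↑((if h (i+1) (j+1) = c then {(i+1+1,j+1)} else ∅) ∪
            (if h i (j+1) = c then {(i,j+1)} else ∅) ∪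
            (if v (i+1) (j+1) = c then {(i+1,j+1+1)} else ∅) ∪
            (if v (i+1) j = c then {(i+1,j)} else ∅) : Finset (Fin (n+3) × Fin (m+3))) := by
        ext x
        rw [mem_neighborSet, fromEdgeSet_adj, mem_cls]
        simp only [Finset.coe_union, Set.mem_union, Finset.mem_coe]
        have e1 : ∀ (P : Prop) [Decidable P] (y : Fin (n+3) × Fin (m+3)),
            x ∈ (if P then {y} else ∅ : Finset (Fin (n+3) × Fin (m+3))) ↔ P ∧ x = y := by
          intro P _ y
          split_ifs with hP <;> simp [hP]
        rw [e1, e1, e1, e1]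
        constructor
        · tauto
        · intro hx
          refine ⟨by tauto, ?_⟩
          rintro rfl
          simp only [Prod.mk.injEq] at hx
          grind
      have e2 : ∀ (P : Prop) [Decidable P] (y : Fin (n+3) × Fin (m+3)),
            (if P then {y} else ∅ : Finset (Fin (n+3) × Fin (m+3))).card = if P then 1 else 0 := by
          intro P _ y
          split_ifs with hP <;> simp
      have e3 : ∀ (P Q : Prop) [Decidable P] [Decidable Q] (y z : Fin (n+3) × Fin (m+3)), y ≠ z →
            Disjoint (if P then {y} else ∅ : Finset (Fin (n+3) × Fin (m+3)))
              (if Q then {z} else ∅) := by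
          intro P Q _ _ y z hyz
          split_ifs <;> simp [hyz]
      have hdd := hd i j c
      unfold vertDegree
      rw [key, Set.ncard_coe_finset, Finset.card_union_of_disjoint, Finset.card_union_of_disjoint,
        Finset.card_union_of_disjoint, e2, e2, e2, e2]
      · simpa only [deg, Finset.mem_insert, Finset.mem_singleton] using hdd
      · apply e3; simp only [ne_eq, Prod.mk.injEq]; grind
      · rw [Finset.disjoint_union_left]
        constructor <;> apply e3 <;> simp only [ne_eq, Prod.mk.injEq] <;> grind
      · rw [Finset.disjoint_union_left, Finset.disjoint_union_left]
        refine ⟨⟨?_, ?_⟩, ?_⟩ <;> apply e3 <;> simp only [ne_eq, Prod.mk.injEq] <;> grind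
    · have C : (fromEdgeSet (cls h v c)).Coloring Bool := by
        refine Coloring.mk (fun x => p c x.1 x.2) ?_
        rintro ⟨i, j⟩ x hx
        obtain ⟨i, rfl⟩ : ∃ k, i = k + 1 := ⟨i - 1, by abel⟩
        obtain ⟨j, rfl⟩ : ∃ k, j = k + 1 := ⟨j - 1, by abel⟩
        rw [fromEdgeSet_adj, mem_cls] at hx
        rcases hx.1 with (⟨rfl, rfl⟩ | ⟨rfl, rfl⟩ | ⟨rfl, rfl⟩ | ⟨rfl, rfl⟩)
        · exact hh _ _
        · exact (hh _ _).symm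
        · exact hv _ _
        · exact (hv _ _).symm
      simpa using C.colorable

/-- Allowed cyclic transitions in a pattern of length five whose last two entries may repeat. -/
def T5 (a b : Fin 5) : Prop := b = a + 1 ∨ (a = 4 ∧ b = 3)

instance (a b : Fin 5) : Decidable (T5 a b) := by unfold T5; infer_instance

/-- Position in the pattern of length five. -/
def red {n : ℕ} (i : Fin (n+3)) : Fin 5 :=
  if i.val = 0 then 0 else if i.val = 1 then 1 else if i.val = 2 then 2 else
    if i.val % 2 = 1 then 3 else 4

lemma red_T {n : ℕ} (hn : 2 ≤ n) (he : n % 2 = 0) (i : Fin (n+3)) : T5 (red i) (red (i+1)) := by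
  have hv : (i+1).val = if i.val = n+2 then 0 else i.val + 1 := by
    have := Fin.val_add_one (n := n+2) i
    rw [this]
    simp [Fin.ext_iff]
  have hi := i.isLt
  unfold red
  rw [hv]
  by_cases hl : i.val = n + 2
  · rw [if_pos hl]
    split_ifs <;> first | (exfalso; omega) | decide
  · rw [if_neg hl]
    split_ifs <;> first | (exfalso; omega) | decide

lemma red_surj {n : ℕ} (hn : 2 ≤ n) (a : Fin 5) : ∃ i : Fin (n+3), red i = a := by
  refine ⟨⟨a.val, by omega⟩, ?_⟩
  have key : ∀ a : Fin 5, (if a.val = 0 then 0 else if a.val = 1 then 1 else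
    if a.val = 2 then 2 else if a.val % 2 = 1 then 3 else 4 : Fin 5) = a := by decide
  exact key a

def hA : Fin 3 → Fin 3 → Fin 3 := ![![0, 2, 2], ![1, 1, 0], ![0, 1, 1]]
def vA : Fin 3 → Fin 3 → Fin 3 := ![![1, 2, 1], ![1, 2, 0], ![0, 0, 1]]
def pA : Fin 3 → Fin 3 → Fin 3 → Bool := ![![![false, false, true], ![true, true, false], ![true, false, true]], ![![true, false, false], ![true, false, true], ![false, true, true]], ![![true, true, false], ![true, false, true], ![true, true, true]]]

def hB : Fin 5 → Fin 3 → Fin 3 := ![![0, 2, 2], ![0, 1, 1], ![1, 1, 0], ![0, 1, 1], ![1, 1, 0]]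
def vB : Fin 5 → Fin 3 → Fin 3 := ![![1, 2, 0], ![1, 2, 1], ![0, 0, 1], ![0, 0, 1], ![0, 0, 1]]
def pB : Fin 3 → Fin 5 → Fin 3 → Bool := ![![![true, true, false], ![false, false, true], ![true, false, true], ![false, true, false], ![true, false, true]], ![![true, false, true], ![true, false, false], ![false, true, true], ![true, false, false], ![false, true, true]], ![![true, true, false], ![false, false, true], ![true, true, true], ![true, true, true], ![true, true, true]]]

def hC : Fin 5 → Fin 5 → Fin 3 := ![![0, 2, 0, 0, 0], ![1, 2, 1, 2, 2], ![2, 1, 1, 1, 1], ![0, 2, 0, 1, 1], ![2, 1, 1, 1, 1]]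
def vC : Fin 5 → Fin 5 → Fin 3 := ![![2, 1, 0, 1, 0], ![1, 1, 0, 2, 0], ![1, 2, 2, 1, 2], ![2, 1, 0, 0, 0], ![2, 1, 0, 0, 0]]
def pC : Fin 3 → Fin 5 → Fin 5 → Bool := ![![![true, false, false, true, false], ![false, true, true, false, true], ![false, true, false, true, true], ![true, false, false, true, false], ![false, false, true, false, true]], ![![true, false, true, true, false], ![true, false, true, false, false], ![false, true, false, false, true], ![true, false, true, true, false], ![false, true, false, false, true]], ![![true, false, true, false, false], ![true, true, false, true, false], ![false, false, true, false, true], ![true, false, true, true, false], ![false, true, false, true, true]]]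


theorem caseC : (∀ a aq b bq, T5 a aq → T5 b bq → ∀ c,
    deg (hC aq bq) (hC a bq) (vC aq bq) (vC aq b) c) := by decide +kernel

end ECD

/-- For odd `s ≥ t ≥ 3`, the edge set of `C_s □ C_t` admits an even
cycle decomposition of size 3: a partition into three nonempty classes, the edges
of each class forming a disjoint union of even cycles. -/
theorem evenCycleDecomposition_cycle_boxProd_cycle (s t : ℕ) (hts : t ≤ s) (ht : 3 ≤ t)
    (hs_odd : Odd s) (ht_odd : Odd t) :
    ∃ E : Fin 3 → Set (Sym2 (Fin s × Fin t)),
      (∀ i, (E i).Nonempty) ∧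
      (∀ i, E i ⊆ (cycleGraph s □ cycleGraph t).edgeSet) ∧
      (⋃ i, E i) = (cycleGraph s □ cycleGraph t).edgeSet ∧
      (∀ i j, i ≠ j → Disjoint (E i) (E j)) ∧
      (∀ i, IsDisjointUnionOfEvenCycles (SimpleGraph.fromEdgeSet (E i))) := by
  obtain ⟨n, rfl⟩ : ∃ n, s = n + 3 := ⟨s - 3, by omega⟩
  obtain ⟨m, rfl⟩ : ∃ m, t = m + 3 := ⟨t - 3, by omega⟩
  have hn : n % 2 = 0 := by rw [Nat.odd_iff] at hs_odd; omega
  have hm : m % 2 = 0 := by rw [Nat.odd_iff] at ht_odd; omega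
  rcases Nat.eq_zero_or_pos m with rfl | hm0
  · rcases Nat.eq_zero_or_pos n with rfl | hn0
    · exact ECD.main ECD.hA ECD.vA ECD.pA (by decide +kernel) (by decide +kernel)
        (by decide +kernel) (by decide +kernel)
    · have hn2 : 2 ≤ n := by omega
      have hT := ECD.red_T hn2 hn
      refine ECD.main (fun i j => ECD.hB (ECD.red i) j) (fun i j => ECD.vB (ECD.red i) j)
        (fun c i j => ECD.pB c (ECD.red i) j) ?_ ?_ ?_ ?_
      · intro c
        obtain ⟨a, b, hab⟩ : ∃ a b, ECD.hB a b = c := by revert c; decide +kernel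
        obtain ⟨i, rfl⟩ := ECD.red_surj hn2 a
        exact ⟨i, b, hab⟩
      · intro i j c
        have key : ∀ a aq b, ECD.T5 a aq → ∀ c, ECD.deg (ECD.hB aq (b+1)) (ECD.hB a (b+1))
            (ECD.vB aq (b+1)) (ECD.vB aq b) c := by decide +kernel
        exact key _ _ j (hT i) c
      · intro i j
        have key : ∀ a aq b, ECD.T5 a aq →
            ECD.pB (ECD.hB a b) a b ≠ ECD.pB (ECD.hB a b) aq b := by decide +kernel
        exact key _ _ j (hT i)
      · intro i j
        have key : ∀ a b, ECD.pB (ECD.vB a b) a b ≠ ECD.pB (ECD.vB a b) a (b+1) := by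
          decide +kernel
        exact key _ j
  · have hn2 : 2 ≤ n := by omega
    have hm2 : 2 ≤ m := by omega
    have hT := ECD.red_T hn2 hn
    have hTq := ECD.red_T hm2 hm
    refine ECD.main (fun i j => ECD.hC (ECD.red i) (ECD.red j))
      (fun i j => ECD.vC (ECD.red i) (ECD.red j))
      (fun c i j => ECD.pC c (ECD.red i) (ECD.red j)) ?_ ?_ ?_ ?_
    · intro c
      obtain ⟨a, b, hab⟩ : ∃ a b, ECD.hC a b = c := by revert c; decide +kernel
      obtain ⟨i, rfl⟩ := ECD.red_surj hn2 a
      obtain ⟨j, rfl⟩ := ECD.red_surj hm2 b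
      exact ⟨i, j, hab⟩
    · intro i j c
      exact ECD.caseC _ _ _ _ (hT i) (hTq j) c
    · intro i j
      have key : ∀ a aq b, ECD.T5 a aq →
          ECD.pC (ECD.hC a b) a b ≠ ECD.pC (ECD.hC a b) aq b := by decide +kernel
      exact key _ _ _ (hT i)
    · intro i j
      have key : ∀ a b bq, ECD.T5 b bq →
          ECD.pC (ECD.vC a b) a b ≠ ECD.pC (ECD.vC a b) a bq := by decide +kernel
      exact key _ _ _ (hTq j)
end

section
/- Let s, t ≥ 3 be integers. The palette index of the Cartesian product C_s □ C_t equals 1 if s or t is even, and equals 3 if s and t are both odd. -/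
open SimpleGraph

section Torus

variable {m n : ℕ}

/-- The horizontal edge starting at `p`. -/
def hE (p : Fin (m+3) × Fin (n+3)) : Sym2 (Fin (m+3) × Fin (n+3)) := s(p, (p.1 + 1, p.2))

/-- The vertical edge starting at `p`. -/
def vE (p : Fin (m+3) × Fin (n+3)) : Sym2 (Fin (m+3) × Fin (n+3)) := s(p, (p.1, p.2 + 1))

lemma fin_one_ne (k : ℕ) : (1 : Fin (k+3)) ≠ 0 := by
  intro h
  have := congrArg Fin.val h
  simp at this

lemma fin_two_ne (k : ℕ) : (1 : Fin (k+3)) + 1 ≠ 0 := by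
  intro h
  have := congrArg Fin.val h
  rw [Fin.val_add] at this
  simp only [Fin.val_one, Fin.val_zero] at this
  rw [Nat.mod_eq_of_lt (by omega)] at this
  omega

lemma fin_add_two_ne {k : ℕ} (a : Fin (k+3)) : a + 1 + 1 ≠ a := by
  intro h
  rw [add_assoc] at h
  exact fin_two_ne k (by simpa using h)

lemma fin_add_one_ne {k : ℕ} (a : Fin (k+3)) : a + 1 ≠ a := by
  intro h
  exact fin_one_ne k (by simpa using h)

lemma hE_inj {p q : Fin (m+3) × Fin (n+3)} (h : hE p = hE q) : p = q := by
  obtain ⟨a, b⟩ := p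
  obtain ⟨c, d⟩ := q
  simp only [hE, Sym2.eq_iff, Prod.mk.injEq] at h
  rcases h with h | ⟨⟨h1, h2⟩, h3, h4⟩
  · exact Prod.ext h.1.1 h.1.2
  · subst h1
    exact absurd h3 (fin_add_two_ne c)

lemma vE_inj {p q : Fin (m+3) × Fin (n+3)} (h : vE p = vE q) : p = q := by
  obtain ⟨a, b⟩ := p
  obtain ⟨c, d⟩ := q
  simp only [vE, Sym2.eq_iff, Prod.mk.injEq] at h
  rcases h with h | ⟨⟨h1, h2⟩, h3, h4⟩
  · exact Prod.ext h.1.1 h.1.2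
  · subst h2
    exact absurd h4 (fin_add_two_ne d)

lemma hE_ne_vE (p q : Fin (m+3) × Fin (n+3)) : hE p ≠ vE q := by
  obtain ⟨a, b⟩ := p
  obtain ⟨c, d⟩ := q
  intro h
  simp only [vE, hE, Sym2.eq_iff, Prod.mk.injEq] at h
  rcases h with ⟨⟨h1, h2⟩, h3, h4⟩ | ⟨⟨h1, h2⟩, h3, h4⟩
  · rw [h1] at h3
    exact fin_add_one_ne c h3
  · rw [h1] at h3
    exact fin_add_one_ne c h3

lemma incident_iff (v : Fin (m+3) × Fin (n+3)) (e : Sym2 (Fin (m+3) × Fin (n+3))) :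
    (e ∈ (cycleGraph (m+3) □ cycleGraph (n+3)).edgeSet ∧ v ∈ e) ↔
      e = hE v ∨ e = hE (v.1 - 1, v.2) ∨ e = vE v ∨ e = vE (v.1, v.2 - 1) := by
  obtain ⟨i, j⟩ := v
  constructor
  · rintro ⟨he, hv⟩
    obtain ⟨⟨k, l⟩, rfl⟩ := hv
    rw [mem_edgeSet, boxProd_adj, cycleGraph_adj, cycleGraph_adj] at he
    simp only at he
    rcases he with ⟨h | h, rfl⟩ | ⟨h | h, rfl⟩
    · right; left
      have : k = i - 1 := by rw [← h]; abel
      subst this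
      simp [hE, Sym2.eq_swap]
    · left
      have : k = i + 1 := by rw [← h]; abel
      subst this
      simp [hE]
    · right; right; right
      have : l = j - 1 := by rw [← h]; abel
      subst this
      simp [vE, Sym2.eq_swap]
    · right; right; left
      have : l = j + 1 := by rw [← h]; abel
      subst this
      simp [vE]
  · rintro (rfl | rfl | rfl | rfl)
    · simp [hE, mem_edgeSet, boxProd_adj, cycleGraph_adj]
    · simp [hE, mem_edgeSet, boxProd_adj, cycleGraph_adj]
    · simp [vE, mem_edgeSet, boxProd_adj, cycleGraph_adj]
    · simp [vE, mem_edgeSet, boxProd_adj, cycleGraph_adj]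

lemma palette_eq (f : Sym2 (Fin (m+3) × Fin (n+3)) → ℕ) (v : Fin (m+3) × Fin (n+3)) :
    palette (cycleGraph (m+3) □ cycleGraph (n+3)) f v =
      {f (hE v), f (hE (v.1 - 1, v.2)), f (vE v), f (vE (v.1, v.2 - 1))} := by
  ext c
  simp only [palette, Set.mem_setOf_eq, ← and_assoc, incident_iff, Set.mem_insert_iff,
    Set.mem_singleton_iff]
  constructor
  · rintro ⟨e, rfl | rfl | rfl | rfl, rfl⟩ <;> simp
  · rintro (rfl | rfl | rfl | rfl)
    · exact ⟨_, Or.inl rfl, rfl⟩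
    · exact ⟨_, Or.inr (Or.inl rfl), rfl⟩
    · exact ⟨_, Or.inr (Or.inr (Or.inl rfl)), rfl⟩
    · exact ⟨_, Or.inr (Or.inr (Or.inr rfl)), rfl⟩

lemma pred_pair_ne (v : Fin (m+3) × Fin (n+3)) : v ≠ (v.1 - 1, v.2) := by
  intro h
  have h1 := congrArg Prod.fst h
  simp only at h1
  have := fin_add_one_ne (v.1 - 1)
  rw [sub_add_cancel] at this
  exact this h1

lemma pred_pair_ne' (v : Fin (m+3) × Fin (n+3)) : v ≠ (v.1, v.2 - 1) := by
  intro h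
  have h1 := congrArg Prod.snd h
  simp only at h1
  have := fin_add_one_ne (v.2 - 1)
  rw [sub_add_cancel] at this
  exact this h1

lemma palette_ncard_s16 (f : Sym2 (Fin (m+3) × Fin (n+3)) → ℕ)
    (hf : IsProperEdgeColoring (cycleGraph (m+3) □ cycleGraph (n+3)) f)
    (v : Fin (m+3) × Fin (n+3)) :
    (palette (cycleGraph (m+3) □ cycleGraph (n+3)) f v).ncard = 4 := by
  have key : ∀ e e', (e = hE v ∨ e = hE (v.1 - 1, v.2) ∨ e = vE v ∨ e = vE (v.1, v.2 - 1)) →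
      (e' = hE v ∨ e' = hE (v.1 - 1, v.2) ∨ e' = vE v ∨ e' = vE (v.1, v.2 - 1)) → e ≠ e' →
      f e ≠ f e' := by
    intro e e' h h' hne
    rw [← incident_iff] at h h'
    exact hf e h.1 e' h'.1 hne ⟨v, h.2, h'.2⟩
  rw [palette_eq]
  have h1 : f (hE v) ≠ f (hE (v.1 - 1, v.2)) :=
    key _ _ (by simp) (by simp) fun h => pred_pair_ne v (hE_inj h)
  have h2 : f (hE v) ≠ f (vE v) := key _ _ (by simp) (by simp) (hE_ne_vE _ _)
  have h3 : f (hE v) ≠ f (vE (v.1, v.2 - 1)) := key _ _ (by simp) (by simp) (hE_ne_vE _ _)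
  have h4 : f (hE (v.1 - 1, v.2)) ≠ f (vE v) := key _ _ (by simp) (by simp) (hE_ne_vE _ _)
  have h5 : f (hE (v.1 - 1, v.2)) ≠ f (vE (v.1, v.2 - 1)) :=
    key _ _ (by simp) (by simp) (hE_ne_vE _ _)
  have h6 : f (vE v) ≠ f (vE (v.1, v.2 - 1)) :=
    key _ _ (by simp) (by simp) fun h => pred_pair_ne' v (vE_inj h)
  rw [Set.ncard_insert_of_notMem (by simp [h1, h2, h3]),
    Set.ncard_insert_of_notMem (by simp [h4, h5]), Set.ncard_pair h6]

/-- A local description of a coloring gives a proper edge coloring. -/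
lemma exists_coloring_s16 (H V : Fin (m+3) × Fin (n+3) → ℕ)
    (hl : ∀ v, [H v, H (v.1 - 1, v.2), V v, V (v.1, v.2 - 1)].Nodup) :
    ∃ f, IsProperEdgeColoring (cycleGraph (m+3) □ cycleGraph (n+3)) f ∧
      ∀ v, palette (cycleGraph (m+3) □ cycleGraph (n+3)) f v =
        {H v, H (v.1 - 1, v.2), V v, V (v.1, v.2 - 1)} := by
  classical
  let f : Sym2 (Fin (m+3) × Fin (n+3)) → ℕ := fun e =>
    if h : ∃ p, e = hE p then H h.choose
    else if h : ∃ p, e = vE p then V h.choose else 0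
  have fh : ∀ p, f (hE p) = H p := by
    intro p
    have h : ∃ q, hE p = hE q := ⟨p, rfl⟩
    simp only [f]
    rw [dif_pos h, ← hE_inj h.choose_spec]
  have fv : ∀ p, f (vE p) = V p := by
    intro p
    have h : ∃ q, vE p = vE q := ⟨p, rfl⟩
    have h' : ¬ ∃ q, vE p = hE q := fun ⟨q, hq⟩ => hE_ne_vE q p hq.symm
    simp only [f]
    rw [dif_neg h', dif_pos h, ← vE_inj h.choose_spec]
  refine ⟨f, ?_, ?_⟩
  · rintro e he e' he' hne ⟨v, hv, hv'⟩
    have h1 := (incident_iff v e).1 ⟨he, hv⟩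
    have h2 := (incident_iff v e').1 ⟨he', hv'⟩
    have := hl v
    simp only [List.nodup_cons, List.mem_cons, List.not_mem_nil, or_false, not_or,
      not_false_eq_true, List.nodup_nil, and_true] at this
    obtain ⟨⟨a, b, c⟩, ⟨d, g⟩, k⟩ := this
    rcases h1 with rfl | rfl | rfl | rfl <;> rcases h2 with rfl | rfl | rfl | rfl <;>
      simp only [fh, fv, ne_eq, not_true_eq_false] at hne ⊢ <;>
      first | assumption | (apply Ne.symm; assumption)
  · intro v
    rw [palette_eq]
    simp only [fh, fv]

end Torus

lemma even_color {W : Type*} [Fintype W] (G : SimpleGraph W) (f : Sym2 W → ℕ)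
    (hf : IsProperEdgeColoring G f) (c : ℕ) [DecidablePred fun v => c ∈ palette G f v] :
    Even (Finset.univ.filter fun v => c ∈ palette G f v).card := by
  have h1 : ∀ v, c ∈ palette G f v → ∃ w, G.Adj v w ∧ f s(v, w) = c := by
    rintro v ⟨e, he, ⟨w, rfl⟩, hc⟩
    exact ⟨w, he, hc⟩
  choose! g hg hc using h1
  have hmem : ∀ v, c ∈ palette G f v → c ∈ palette G f (g v) := by
    intro v hv
    exact ⟨s(v, g v), hg v hv, by simp, hc v hv⟩
  have hinv : ∀ v, c ∈ palette G f v → g (g v) = v := by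
    intro v hv
    by_contra hne
    refine hf s(v, g v) (hg v hv) s(g v, g (g v)) (hg _ (hmem v hv)) ?_ ⟨g v, by simp, by simp⟩ ?_
    · intro h
      rw [Sym2.eq_iff] at h
      rcases h with h | h
      · exact (hg v hv).ne h.1
      · exact hne h.1.symm
    · rw [hc v hv, hc _ (hmem v hv)]
  have : ∑ v ∈ Finset.univ.filter (fun v => c ∈ palette G f v), (1 : ZMod 2) = 0 := by
    refine Finset.sum_involution (fun v _ => g v) ?_ ?_ ?_ ?_
    · intro a _; decide
    · intro a ha _ h
      exact (hg a (Finset.mem_filter.1 ha).2).ne h.symm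
    · intro a ha
      exact Finset.mem_filter.2 ⟨Finset.mem_univ _, hmem a (Finset.mem_filter.1 ha).2⟩
    · intro a ha
      exact hinv a (Finset.mem_filter.1 ha).2
  rw [Finset.sum_const, nsmul_eq_mul, mul_one, ZMod.natCast_eq_zero_iff] at this
  exact even_iff_two_dvd.2 this

lemma three_le_numPalettes {m n : ℕ} (hm : Odd (m+3)) (hn : Odd (n+3))
    (f : Sym2 (Fin (m+3) × Fin (n+3)) → ℕ)
    (hf : IsProperEdgeColoring (cycleGraph (m+3) □ cycleGraph (n+3)) f) :
    3 ≤ numPalettes (cycleGraph (m+3) □ cycleGraph (n+3)) f := by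
  classical
  by_contra hlt
  have hodd : ¬ Even (Finset.univ : Finset (Fin (m+3) × Fin (n+3))).card := by
    rw [Finset.card_univ, Fintype.card_prod, Fintype.card_fin, Fintype.card_fin,
      Nat.not_even_iff_odd]
    exact hm.mul hn
  set G := cycleGraph (m+3) □ cycleGraph (n+3) with hG
  have hcard : ∀ v, (palette G f v).ncard = 4 := palette_ncard_s16 f hf
  have hfin : ∀ v, (palette G f v).Finite := fun v =>
    Set.finite_of_ncard_ne_zero (by rw [hcard v]; norm_num)
  have hdiff : ∀ v w, palette G f v ≠ palette G f w → ∃ c, c ∈ palette G f v ∧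
      c ∉ palette G f w := by
    intro v w hne
    by_contra hcon
    push Not at hcon
    exact hne (Set.eq_of_subset_of_ncard_le hcon (by rw [hcard, hcard]) (hfin w))
  by_cases hall : ∀ v, palette G f v = palette G f (0, 0)
  · have hne : (palette G f (0,0)).Nonempty :=
      Set.nonempty_of_ncard_ne_zero (by rw [hcard]; norm_num)
    obtain ⟨c, hc⟩ := hne
    have := even_color G f hf c
    rw [Finset.filter_true_of_mem (fun v _ => by rw [hall v]; exact hc)] at this
    exact hodd this
  · push Not at hall
    obtain ⟨w, hw⟩ := hall
    have h2 : ∀ v, palette G f v = palette G f (0,0) ∨ palette G f v = palette G f w := by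
      intro v
      by_contra hcon
      push Not at hcon
      apply hlt
      exact (Set.two_lt_ncard (Set.finite_range _)).2 ⟨_, ⟨v, rfl⟩, _, ⟨(0,0), rfl⟩, _, ⟨w, rfl⟩,
        hcon.1, hcon.2, hw.symm⟩
    obtain ⟨c, hc, hc'⟩ := hdiff _ _ hw
    obtain ⟨d, hd, hd'⟩ := hdiff _ _ hw.symm
    have e1 := even_color G f hf c
    have e2 := even_color G f hf d
    have : (Finset.univ.filter fun v => d ∈ palette G f v) =
        Finset.univ.filter fun v => ¬ c ∈ palette G f v := by
      ext v
      simp only [Finset.mem_filter, Finset.mem_univ, true_and]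
      rcases h2 v with h | h <;> rw [h] <;> simp [hc, hc', hd, hd']
    rw [this] at e2
    have h3 := Finset.card_filter_add_card_filter_not (s := (Finset.univ :
      Finset (Fin (m+3) × Fin (n+3)))) (fun v => c ∈ palette G f v)
    exact hodd (h3 ▸ e1.add e2)

/-- Folding of cycle edges: edges of a cycle are labelled `0, 1, 2, 1, 2, …`. -/
def hfold (i : ℕ) : ℕ := if i = 0 then 0 else if i % 2 = 1 then 1 else 2

/-- Folding of the vertices of an odd cycle to a triangle. -/
def vfold (i : ℕ) : ℕ := min i 2

/-- Horizontal colors of the base coloring of `C_3 □ C_3`. -/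
def baseH (i j : ℕ) : ℕ := ([[0, 0, 3], [1, 2, 0], [5, 3, 5]].getD i []).getD j 0

/-- Vertical colors of the base coloring of `C_3 □ C_3`. -/
def baseV (i j : ℕ) : ℕ := ([[1, 2, 4], [3, 1, 2], [0, 1, 4]].getD i []).getD j 0

lemma val_pred {k : ℕ} (i : Fin (k+3)) :
    (i.val = 0 ∧ (i - 1).val = k + 2) ∨ (i.val ≠ 0 ∧ (i - 1).val = i.val - 1) := by
  by_cases h : i = 0
  · left
    subst h
    refine ⟨rfl, ?_⟩
    simp [Fin.val_sub]
  · right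
    exact ⟨fun h' => h (Fin.ext h'), Fin.val_sub_one_of_ne_zero h⟩

lemma fold_odd {k : ℕ} (hk : Odd (k+3)) (i : Fin (k+3)) :
    (hfold (i - 1).val = 2 ∧ hfold i.val = 0 ∧ vfold i.val = 0) ∨
    (hfold (i - 1).val = 0 ∧ hfold i.val = 1 ∧ vfold i.val = 1) ∨
    (hfold (i - 1).val = 1 ∧ hfold i.val = 2 ∧ vfold i.val = 2) ∨
    (hfold (i - 1).val = 2 ∧ hfold i.val = 1 ∧ vfold i.val = 2) := by
  have hk' := Nat.odd_iff.1 hk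
  unfold hfold vfold
  rcases val_pred i with ⟨h1, h2⟩ | ⟨h1, h2⟩ <;> rw [h2]
  · left; rw [h1]; refine ⟨?_, by simp, by simp⟩
    rw [if_neg (by omega), if_neg (by omega)]
  · split_ifs <;> omega

lemma fold_any {k : ℕ} (i : Fin (k+3)) :
    hfold (i - 1).val ≠ hfold i.val ∧ hfold (i - 1).val ≤ 2 ∧ hfold i.val ≤ 2 := by
  unfold hfold
  rcases val_pred i with ⟨h1, h2⟩ | ⟨h1, h2⟩ <;> rw [h2]
  · rw [h1, if_neg (by omega : ¬ k + 2 = 0), if_pos rfl]; refine ⟨?_, ?_, ?_⟩ <;> (try split_ifs) <;> omega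
  · refine ⟨?_, ?_, ?_⟩ <;> split_ifs <;> omega

/-- Color used across the paired direction. -/
def crossC (i a b : ℕ) : ℕ := if i % 2 = 0 then 3 - a - b else 3

lemma even_local {m n : ℕ} (hm : Even (m+3)) (i : Fin (m+3)) (j : Fin (n+3)) :
    [crossC i.val (hfold (j-1).val) (hfold j.val),
      crossC (i-1).val (hfold (j-1).val) (hfold j.val), hfold j.val, hfold (j-1).val].Nodup ∧
    ({crossC i.val (hfold (j-1).val) (hfold j.val),
      crossC (i-1).val (hfold (j-1).val) (hfold j.val), hfold j.val, hfold (j-1).val} : Set ℕ)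
      = {0,1,2,3} := by
  obtain ⟨h1, h2, h3⟩ := fold_any j
  have hm' := Nat.even_iff.1 hm
  generalize hfold (j-1).val = a at *
  generalize hfold j.val = b at *
  have hp : (i.val % 2 = 0 ∧ (i-1).val % 2 = 1) ∨ (i.val % 2 = 1 ∧ (i-1).val % 2 = 0) := by
    rcases val_pred i with ⟨h1, h2⟩ | ⟨h1, h2⟩ <;> omega
  unfold crossC
  rcases hp with ⟨p, q⟩ | ⟨p, q⟩ <;> rw [p, q] <;> interval_cases a <;> interval_cases b <;>
    first
    | exact absurd rfl h1
    | (refine ⟨by decide, ?_⟩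
       ext x
       simp only [Set.mem_insert_iff, Set.mem_singleton_iff]
       norm_num
       try omega)

lemma paletteIndex_one_of {W : Type*} [Finite W] [Nonempty W] (G : SimpleGraph W) (f : Sym2 W → ℕ)
    (hf : IsProperEdgeColoring G f) (P : Set ℕ) (h : ∀ v, palette G f v = P) :
    paletteIndex G = 1 := by
  have hmem : 1 ∈ {n | ∃ f, IsProperEdgeColoring G f ∧ numPalettes G f = n} := by
    refine ⟨f, hf, ?_⟩
    have : palette G f = fun _ => P := funext h
    simp [numPalettes, this]
  apply le_antisymm (Nat.sInf_le hmem)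
  refine le_csInf ⟨1, hmem⟩ ?_
  rintro k ⟨g, hg, rfl⟩
  exact (Set.ncard_pos (Set.finite_range _)).2 (Set.range_nonempty _)

lemma even_case_left {m n : ℕ} (hm : Even (m+3)) :
    paletteIndex (cycleGraph (m+3) □ cycleGraph (n+3)) = 1 := by
  obtain ⟨f, hf, hp⟩ := exists_coloring_s16 (m := m) (n := n)
    (fun v => crossC v.1.val (hfold (v.2-1).val) (hfold v.2.val)) (fun v => hfold v.2.val)
    (fun v => (even_local hm v.1 v.2).1)
  exact paletteIndex_one_of _ f hf _ fun v => (hp v).trans (even_local hm v.1 v.2).2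

lemma even_case_right {m n : ℕ} (hn : Even (n+3)) :
    paletteIndex (cycleGraph (m+3) □ cycleGraph (n+3)) = 1 := by
  obtain ⟨f, hf, hp⟩ := exists_coloring_s16 (m := m) (n := n)
    (fun v => hfold v.1.val) (fun v => crossC v.2.val (hfold (v.1-1).val) (hfold v.1.val))
    (fun v => ((List.perm_append_comm (l₁ := [_, _]) (l₂ := [_, _])).nodup_iff).1
      (even_local hn v.2 v.1).1)
  refine paletteIndex_one_of _ f hf _ fun v => (hp v).trans (Eq.trans ?_ (even_local hn v.2 v.1).2)
  ext x
  simp only [Set.mem_insert_iff, Set.mem_singleton_iff]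
  tauto

lemma odd_local {m n : ℕ} (hm : Odd (m+3)) (hn : Odd (n+3)) (i : Fin (m+3)) (j : Fin (n+3)) :
    [baseH (hfold i.val) (vfold j.val), baseH (hfold (i-1).val) (vfold j.val),
      baseV (vfold i.val) (hfold j.val), baseV (vfold i.val) (hfold (j-1).val)].Nodup ∧
    (({baseH (hfold i.val) (vfold j.val), baseH (hfold (i-1).val) (vfold j.val),
      baseV (vfold i.val) (hfold j.val), baseV (vfold i.val) (hfold (j-1).val)} : Finset ℕ)
      ∈ ({{0,1,2,3}, {2,3,4,5}, {0,1,4,5}} : Finset (Finset ℕ))) := by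
  rcases fold_odd hm i with ⟨a, b, c⟩ | ⟨a, b, c⟩ | ⟨a, b, c⟩ | ⟨a, b, c⟩ <;>
  rcases fold_odd hn j with ⟨a', b', c'⟩ | ⟨a', b', c'⟩ | ⟨a', b', c'⟩ | ⟨a', b', c'⟩ <;>
  rw [a, b, c, a', b', c'] <;> decide

lemma odd_case {m n : ℕ} (hm : Odd (m+3)) (hn : Odd (n+3)) :
    paletteIndex (cycleGraph (m+3) □ cycleGraph (n+3)) = 3 := by
  obtain ⟨f, hf, hp⟩ := exists_coloring_s16 (m := m) (n := n)
    (fun v => baseH (hfold v.1.val) (vfold v.2.val))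
    (fun v => baseV (vfold v.1.val) (hfold v.2.val))
    (fun v => (odd_local hm hn v.1 v.2).1)
  have hle : numPalettes (cycleGraph (m+3) □ cycleGraph (n+3)) f ≤ 3 := by
    let S : Finset (Finset ℕ) := {{0,1,2,3}, {2,3,4,5}, {0,1,4,5}}
    have hsub : Set.range (palette (cycleGraph (m+3) □ cycleGraph (n+3)) f) ⊆
        (fun x : Finset ℕ => (x : Set ℕ)) '' (S : Set (Finset ℕ)) := by
      rintro _ ⟨v, rfl⟩
      refine ⟨_, (odd_local hm hn v.1 v.2).2, ?_⟩
      rw [hp v]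
      simp
    calc _ ≤ _ := Set.ncard_le_ncard hsub (S.finite_toSet.image _)
      _ ≤ _ := Set.ncard_image_le S.finite_toSet
      _ = S.card := Set.ncard_coe_finset S
      _ ≤ 3 := by decide
  have hmem : 3 ∈ {k | ∃ f, IsProperEdgeColoring (cycleGraph (m+3) □ cycleGraph (n+3)) f ∧
      numPalettes (cycleGraph (m+3) □ cycleGraph (n+3)) f = k} :=
    ⟨f, hf, le_antisymm hle (three_le_numPalettes hm hn f hf)⟩
  apply le_antisymm (Nat.sInf_le hmem)
  refine le_csInf ⟨3, hmem⟩ ?_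
  rintro k ⟨g, hg, rfl⟩
  exact three_le_numPalettes hm hn g hg

/-- For `s, t ≥ 3`, `š(C_s □ C_t) = 1` if `s` or `t` is even, and
`š(C_s □ C_t) = 3` if `s` and `t` are both odd. -/
theorem paletteIndex_cycle_boxProd_cycle (s t : ℕ) (hs : 3 ≤ s) (ht : 3 ≤ t) :
    (Even s ∨ Even t → paletteIndex (cycleGraph s □ cycleGraph t) = 1) ∧
    (Odd s ∧ Odd t → paletteIndex (cycleGraph s □ cycleGraph t) = 3) := by
  obtain ⟨m, rfl⟩ := Nat.exists_eq_add_of_le' hs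
  obtain ⟨n, rfl⟩ := Nat.exists_eq_add_of_le' ht
  refine ⟨?_, fun h => odd_case h.1 h.2⟩
  rintro (h | h)
  · exact even_case_left h
  · exact even_case_right h
end

section
/- Let G be a finite regular simple graph with at least one edge and let s ≥ 3 be an integer. Then: (i) the palette index of the Cartesian product C_s □ G is at most š(G) + 2; (ii) if s is even or G is class 1, then the palette index of C_s □ G equals 1; (iii) if G is a class 2 cubic (3-regular) graph possessing a perfect matching and s is odd, then the palette index of C_s □ G belongs to {1, 3}. -/
open SimpleGraph

namespace PalAux

lemma proper_iff {V : Type*} (G : SimpleGraph V) (f : Sym2 V → ℕ) :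
    IsProperEdgeColoring G f ↔
      ∀ v a b, G.Adj v a → G.Adj v b → a ≠ b → f s(v, a) ≠ f s(v, b) := by
  constructor
  · intro h v a b ha hb hab
    refine h _ ha _ hb ?_ ⟨v, by simp, by simp⟩
    intro he
    exact hab (Sym2.congr_right.1 he)
  · rintro h e₁ h₁ e₂ h₂ hne ⟨v, hv₁, hv₂⟩
    obtain ⟨a, rfl⟩ := hv₁
    obtain ⟨b, rfl⟩ := hv₂
    exact h v a b h₁ h₂ (fun hab => hne (by rw [hab]))

lemma mem_palette {V : Type*} (G : SimpleGraph V) (f : Sym2 V → ℕ) (v : V) (c : ℕ) :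
    c ∈ palette G f v ↔ ∃ a, G.Adj v a ∧ f s(v, a) = c := by
  constructor
  · rintro ⟨e, he, hv, hc⟩
    obtain ⟨a, rfl⟩ := hv
    exact ⟨a, he, hc⟩
  · rintro ⟨a, ha, hc⟩
    exact ⟨s(v, a), ha, by simp, hc⟩

lemma palette_eq_image {V : Type*} (G : SimpleGraph V) (f : Sym2 V → ℕ) (v : V) :
    palette G f v = (fun a => f s(v, a)) '' G.neighborSet v := by
  ext c
  rw [mem_palette]
  rfl

lemma palette_ncard {V : Type*} (G : SimpleGraph V) (f : Sym2 V → ℕ)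
    (hf : IsProperEdgeColoring G f) (v : V) : (palette G f v).ncard = vertDegree G v := by
  rw [palette_eq_image, vertDegree]
  apply Set.InjOn.ncard_image
  intro a ha b hb hab
  by_contra hne
  exact (proper_iff G f).1 hf v a b ha hb hne hab

lemma palette_finite {V : Type*} [Finite V] (G : SimpleGraph V) (f : Sym2 V → ℕ) (v : V) :
    (palette G f v).Finite := by
  rw [palette_eq_image]
  exact (Set.toFinite _).image _

lemma palette_eq_of_subset {V : Type*} (G : SimpleGraph V) (f : Sym2 V → ℕ)
    (hf : IsProperEdgeColoring G f) (v : V) (S : Finset ℕ) (hS : S.card ≤ vertDegree G v)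
    (hsub : ∀ c ∈ palette G f v, c ∈ S) : palette G f v = ↑S := by
  apply Set.eq_of_subset_of_ncard_le (fun c hc => hsub c hc)
  · rw [palette_ncard G f hf, Set.ncard_coe_finset]
    exact hS

lemma palette_comp {V : Type*} (G : SimpleGraph V) (f : Sym2 V → ℕ) (σ : ℕ → ℕ) (v : V) :
    palette G (fun e => σ (f e)) v = σ '' palette G f v := by
  rw [palette_eq_image, palette_eq_image, Set.image_image]

lemma proper_comp {V : Type*} (G : SimpleGraph V) (f : Sym2 V → ℕ) (σ : ℕ → ℕ)
    (hf : IsProperEdgeColoring G f) (hσ : ∀ v, Set.InjOn σ (palette G f v)) :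
    IsProperEdgeColoring G (fun e => σ (f e)) := by
  rw [proper_iff] at hf ⊢
  intro v a b ha hb hab h
  exact hf v a b ha hb hab (hσ v ((mem_palette _ _ _ _).2 ⟨a, ha, rfl⟩)
    ((mem_palette _ _ _ _).2 ⟨b, hb, rfl⟩) h)

lemma exists_proper {V : Type*} [Finite V] (G : SimpleGraph V) :
    ∃ f, IsProperEdgeColoring G f := by
  obtain ⟨n, ⟨e⟩⟩ := Finite.exists_equiv_fin (Sym2 V)
  refine ⟨fun x => (e x : ℕ), fun a _ b _ hab _ h => hab ?_⟩
  exact e.injective (Fin.ext h)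

lemma paletteIndex_spec {V : Type*} [Finite V] (G : SimpleGraph V) :
    ∃ f, IsProperEdgeColoring G f ∧ numPalettes G f = paletteIndex G := by
  obtain ⟨f, hf⟩ := exists_proper G
  exact Nat.sInf_mem (s := {n | ∃ f, IsProperEdgeColoring G f ∧ numPalettes G f = n}) ⟨_, f, hf, rfl⟩

lemma paletteIndex_le {V : Type*} (G : SimpleGraph V) (f : Sym2 V → ℕ)
    (hf : IsProperEdgeColoring G f) : paletteIndex G ≤ numPalettes G f :=
  Nat.sInf_le ⟨f, hf, rfl⟩

lemma one_le_paletteIndex {V : Type*} [Finite V] [Nonempty V] (G : SimpleGraph V) :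
    1 ≤ paletteIndex G := by
  obtain ⟨f, hf, h⟩ := paletteIndex_spec G
  rw [← h, numPalettes, Nat.succ_le_iff, Set.ncard_pos (Set.finite_range _)]
  exact Set.range_nonempty _

lemma paletteIndex_eq_one {V : Type*} [Finite V] [Nonempty V] (G : SimpleGraph V)
    (f : Sym2 V → ℕ) (hf : IsProperEdgeColoring G f) (S : Set ℕ)
    (hS : ∀ v, palette G f v = S) : paletteIndex G = 1 := by
  apply le_antisymm _ (one_le_paletteIndex G)
  refine (paletteIndex_le G f hf).trans ?_
  have : Set.range (palette G f) = {S} := by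
    ext T
    simp [hS, eq_comm]
  rw [numPalettes, this, Set.ncard_singleton]

/-- The palette index of a regular graph is never two. -/
lemma paletteIndex_ne_two {V : Type*} [Finite V] [Nonempty V] (G : SimpleGraph V) (r : ℕ)
    (hr : IsRegularDeg G r) : paletteIndex G ≠ 2 := by
  intro h2
  obtain ⟨f, hf, h⟩ := paletteIndex_spec G
  rw [h2, numPalettes, Set.ncard_eq_two] at h
  obtain ⟨P, Q, hPQ, hrange⟩ := h
  have hmem : ∀ v, palette G f v = P ∨ palette G f v = Q := by
    intro v
    have : palette G f v ∈ Set.range (palette G f) := ⟨v, rfl⟩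
    rw [hrange] at this
    simpa using this
  obtain ⟨p, hp⟩ : P ∈ Set.range (palette G f) := by rw [hrange]; simp
  obtain ⟨q, hq⟩ : Q ∈ Set.range (palette G f) := by rw [hrange]; simp
  have hPfin : P.Finite := hp ▸ palette_finite G f p
  have hQfin : Q.Finite := hq ▸ palette_finite G f q
  have hPc : P.ncard = r := by rw [← hp, palette_ncard G f hf, hr]
  have hQc : Q.ncard = r := by rw [← hq, palette_ncard G f hf, hr]
  have hdiff : (P \ Q).ncard = (Q \ P).ncard := by
    have h1 := Set.ncard_inter_add_ncard_sdiff_eq_ncard P Q hPfin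
    have h2 := Set.ncard_inter_add_ncard_sdiff_eq_ncard Q P hQfin
    rw [Set.inter_comm] at h2
    omega
  have hPd : (P \ Q).Finite := hPfin.subset Set.sdiff_subset
  have hQd : (Q \ P).Finite := hQfin.subset Set.sdiff_subset
  obtain ⟨τ, hτ⟩ : ∃ τ : ℕ → ℕ, Set.BijOn τ (P \ Q) (Q \ P) := by
    apply hPd.exists_bijOn_of_encard_eq
    rw [← hPd.cast_ncard_eq, ← hQd.cast_ncard_eq, hdiff]
  classical
  let σ : ℕ → ℕ := fun c => if c ∈ P \ Q then τ c else c
  have hσQ : ∀ c ∈ Q, σ c = c := by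
    intro c hc
    simp [σ, hc]
  have hσd : ∀ c ∈ P \ Q, σ c = τ c := fun c hc => if_pos hc
  have hinjP : Set.InjOn σ P := by
    intro a ha b hb hab
    by_cases haQ : a ∈ Q <;> by_cases hbQ : b ∈ Q
    · rwa [hσQ a haQ, hσQ b hbQ] at hab
    · rw [hσQ a haQ, hσd b ⟨hb, hbQ⟩] at hab
      exact absurd (hab ▸ ha) (hτ.mapsTo ⟨hb, hbQ⟩).2
    · rw [hσQ b hbQ, hσd a ⟨ha, haQ⟩] at hab
      exact absurd (hab ▸ hb) (hτ.mapsTo ⟨ha, haQ⟩).2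
    · rw [hσd a ⟨ha, haQ⟩, hσd b ⟨hb, hbQ⟩] at hab
      exact hτ.injOn ⟨ha, haQ⟩ ⟨hb, hbQ⟩ hab
  have hinjQ : Set.InjOn σ Q := by
    intro a ha b hb hab
    rwa [hσQ a ha, hσQ b hb] at hab
  have himQ : σ '' Q = Q := by
    rw [Set.image_congr (g := id) hσQ, Set.image_id]
  have himP : σ '' P = Q := by
    ext c
    constructor
    · rintro ⟨a, ha, rfl⟩
      by_cases haQ : a ∈ Q
      · rwa [hσQ a haQ]
      · rw [hσd a ⟨ha, haQ⟩]
        exact (hτ.mapsTo ⟨ha, haQ⟩).1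
    · intro hc
      by_cases hcP : c ∈ P
      · exact ⟨c, hcP, hσQ c hc⟩
      · obtain ⟨a, ha, hac⟩ := hτ.surjOn ⟨hc, hcP⟩
        exact ⟨a, ha.1, by rw [hσd a ha, hac]⟩
  have := paletteIndex_eq_one G (fun e => σ (f e)) (proper_comp G f σ hf (fun v => by
    rcases hmem v with h | h <;> rw [h] <;> assumption)) Q (fun v => by
    rw [palette_comp]
    rcases hmem v with h | h <;> rw [h] <;> assumption)
  omega

/-- A partial proper edge coloring, `0` meaning uncolored (or not an edge). -/
structure PCol {V : Type*} (C : V → V → ℕ) (n : ℕ) : Prop where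
  symm : ∀ a b, C a b = C b a
  diag : ∀ a, C a a = 0
  proper : ∀ v a b, C v a = C v b → C v a ≠ 0 → a = b
  bound : ∀ a b, C a b ≤ n

/-- Kempe swap on a closed set `K`. -/
lemma kempe {V : Type*} (C : V → V → ℕ) (n : ℕ) (hC : PCol C n) (α β : ℕ)
    (hα : α ≠ 0) (hβ : β ≠ 0) (hαn : α ≤ n) (hβn : β ≤ n) (K : Set V)
    (hK : ∀ a b, (C a b = α ∨ C a b = β) → (a ∈ K → b ∈ K)) :
    ∃ C', PCol C' n ∧ (∀ a b, C' a b = 0 ↔ C a b = 0) ∧ (∀ a, a ∉ K → ∀ b, C' a b = C a b) ∧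
      (∀ a, a ∈ K → ∀ b, C' a b = Equiv.swap α β (C a b)) := by
  classical
  have hs0 : Equiv.swap α β 0 = 0 := Equiv.swap_apply_of_ne_of_ne hα.symm hβ.symm
  refine ⟨fun a b => if a ∈ K then Equiv.swap α β (C a b) else C a b, ⟨?_, ?_, ?_, ?_⟩, ?_, ?_, ?_⟩
  · intro a b
    by_cases h : C a b = α ∨ C a b = β
    · have h' : C b a = α ∨ C b a = β := by rwa [hC.symm b a]
      have : a ∈ K ↔ b ∈ K := ⟨hK a b h, hK b a h'⟩
      simp only [this, hC.symm a b]
    · push Not at h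
      have h1 := Equiv.swap_apply_of_ne_of_ne h.1 h.2
      simp only [hC.symm b a, h1, ite_self]
  · intro a
    simp [hC.diag, hs0]
  · intro v a b
    split_ifs with hv
    · intro h h0
      refine hC.proper v a b ((Equiv.swap α β).injective h) ?_
      intro h'
      rw [h', hs0] at h0
      exact h0 rfl
    · exact hC.proper v a b
  · intro a b
    split_ifs with hv
    · rw [Equiv.swap_apply_def]
      split_ifs
      · exact hβn
      · exact hαn
      · exact hC.bound a b
    · exact hC.bound a b
  · intro a b
    dsimp only
    split_ifs with hv
    · rw [← hs0, (Equiv.swap α β).injective.eq_iff, hs0]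
    · rfl
  · intro a ha b
    simp [ha]
  · intro a ha b
    simp [ha]

/-- Shifting a fan. -/
lemma shift {V : Type*} (n : ℕ) (x : V) (α : ℕ) (hα : α ≠ 0) (hαn : α ≤ n) (k : ℕ) :
    ∀ (C : V → V → ℕ) (_ : PCol C n) (y : ℕ → V)
      (_ : ∀ i ≤ k, ∀ j ≤ k, y i = y j → i = j)
      (_ : ∀ i ≤ k, y i ≠ x) (_ : C x (y 0) = 0)
      (_ : ∀ i < k, C x (y (i + 1)) ≠ 0 ∧ ∀ u, C (y i) u ≠ C x (y (i + 1)))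
      (_ : ∀ u, C x u ≠ α) (_ : ∀ u, C (y k) u ≠ α),
      ∃ C', PCol C' n ∧ ∀ a b, C' a b ≠ 0 ↔ (C a b ≠ 0 ∨ s(a, b) = s(x, y 0)) := by
  classical
  induction k with
  | zero =>
    intro C hC y _ hx h0 _ hmx hmy
    have hx0 := hx 0 le_rfl
    refine ⟨fun a b => if s(a, b) = s(x, y 0) then α else C a b, ⟨?_, ?_, ?_, ?_⟩, ?_⟩
    · intro a b
      simp only [hC.symm a b, Sym2.eq_swap (a := a) (b := b)]
    · intro a
      have : s(a, a) ≠ s(x, y 0) := by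
        rw [Ne, Sym2.eq_iff]; grind
      simp only [this, if_false, hC.diag]
    · intro v a b
      have := hC.proper v a b
      simp only [Sym2.eq_iff]
      grind
    · intro a b
      have := hC.bound a b
      split_ifs <;> assumption
    · intro a b
      dsimp only
      split_ifs with h
      · simp [h, hα]
      · simp [h]
  | succ k ih =>
    intro C hC y hinj hx h0 hfan hmx hmy
    have hx0 := hx 0 (by omega)
    have hx1 := hx 1 (by omega)
    have hy01 : y 0 ≠ y 1 := fun h => by
      have := hinj 0 (by omega) 1 (by omega) h
      omega
    obtain ⟨hγ0, hγ⟩ := hfan 0 (by omega)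
    simp only [zero_add] at hγ0 hγ
    set γ := C x (y 1) with hγdef
    let C1 : V → V → ℕ := fun a b =>
      if s(a, b) = s(x, y 0) then γ else if s(a, b) = s(x, y 1) then 0 else C a b
    have hC1 : ∀ a b, C1 a b =
      if s(a, b) = s(x, y 0) then γ else if s(a, b) = s(x, y 1) then 0 else C a b := fun _ _ => rfl
    have hP : PCol C1 n := by
      refine ⟨?_, ?_, ?_, ?_⟩
      · intro a b
        simp only [hC1, hC.symm a b, Sym2.eq_swap (a := a) (b := b)]
      · intro a
        simp only [hC1, Sym2.eq_iff]
        have := hC.diag a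
        grind
      · intro v a b
        have h1 := hC.proper v a b
        have h2 := hC.proper x a (y 1)
        have h3 := hC.proper x b (y 1)
        simp only [hC1, Sym2.eq_iff]
        grind
      · intro a b
        have := hC.bound a b
        have h2 := hC.bound x (y 1)
        simp only [hC1]
        split_ifs <;> omega
    have hother : ∀ a u, a ≠ x → a ≠ y 0 → C1 a u = C a u ∨ C1 a u = 0 := by
      intro a u h1 h2
      simp only [hC1, Sym2.eq_iff]
      grind
    have hxe : ∀ a, a ≠ y 0 → a ≠ y 1 → C1 x a = C x a := by
      intro a h1 h2
      simp only [hC1, Sym2.eq_iff]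
      grind
    obtain ⟨C', hC', hsupp⟩ := ih C1 hP (fun i => y (i + 1))
      (fun i hi j hj h => by
        have := hinj (i + 1) (by omega) (j + 1) (by omega) h
        omega)
      (fun i hi => hx (i + 1) (by omega))
      (by simp only [hC1, Sym2.eq_iff]; grind)
      (fun i hi => by
        obtain ⟨h1, h2⟩ := hfan (i + 1) (by omega)
        have e1 : C1 x (y (i + 1 + 1)) = C x (y (i + 1 + 1)) := by
          apply hxe
          · intro h
            have := hinj (i + 1 + 1) (by omega) 0 (by omega) h
            omega
          · intro h
            have := hinj (i + 1 + 1) (by omega) 1 (by omega) h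
            omega
        rw [e1]
        refine ⟨h1, fun u => ?_⟩
        rcases hother (y (i + 1)) u (hx _ (by omega)) (fun h => by
            have := hinj (i + 1) (by omega) 0 (by omega) h
            omega) with h | h
        · rw [h]; exact h2 u
        · rw [h]; exact h1.symm)
      (fun u => by
        have h1 := hmx u
        have h2 := hmx (y 1)
        simp only [hC1]
        split_ifs
        · exact h2
        · exact hα.symm
        · exact h1)
      (fun u => by
        rcases hother (y (k + 1)) u (hx _ (by omega)) (fun h => by
            have := hinj (k + 1) (by omega) 0 (by omega) h
            omega) with h | h
        · rw [h]; exact hmy u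
        · rw [h]; exact hα.symm)
    refine ⟨C', hC', fun a b => ?_⟩
    rw [hsupp]
    have hs := hC.symm a b
    simp only [hC1, zero_add, Sym2.eq_iff]
    grind

/-- In a graph of maximum degree two, a component has at most two vertices of degree at most one. -/
lemma three_ends {V : Type*} [Fintype V] (C : V → V → ℕ) (n : ℕ) (hC : PCol C n) (α β : ℕ)
    (hα : α ≠ 0) (hβ : β ≠ 0) (B : SimpleGraph V)
    (hB : ∀ a b, B.Adj a b ↔ (C a b = α ∨ C a b = β)) (u v w : V)
    (huv : u ≠ v) (huw : u ≠ w) (hvw : v ≠ w)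
    (hu : ∀ z, C u z ≠ α) (hv : ∀ z, C v z ≠ β) (hw : ∀ z, C w z ≠ β)
    (h1 : B.Reachable u v) (h2 : B.Reachable u w) : False := by
  classical
  let K := B.connectedComponentMk u
  let H := B.induce K.supp
  have hconn : H.Connected := K.connected_toSimpleGraph
  have hle := hconn.card_vert_le_card_edgeSet_add_one
  rw [Nat.card_eq_fintype_card, Nat.card_eq_fintype_card, ← SimpleGraph.edgeFinset_card] at hle
  have hsum := H.sum_degrees_eq_twice_card_edges
  have hdeg2 : ∀ a, H.degree a ≤ 2 := by
    intro a
    rw [← SimpleGraph.card_neighborFinset_eq_degree]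
    have : (H.neighborFinset a).card ≤ ({α, β} : Finset ℕ).card := by
      apply Finset.card_le_card_of_injOn (fun b : K.supp => C a b)
      · intro b hb
        have : H.Adj a b := by simpa using hb
        have : B.Adj a b := this
        rw [hB] at this
        simpa using this
      · intro b hb c hc hbc
        have : H.Adj a b := by simpa using hb
        have : B.Adj a b := this
        rw [hB] at this
        apply Subtype.ext
        apply hC.proper a _ _ hbc
        rcases this with h | h <;> rw [h] <;> assumption
    exact this.trans Finset.card_le_two
  have hdeg1 : ∀ a : K.supp, ((∀ z, C a z ≠ α) ∨ (∀ z, C a z ≠ β)) → H.degree a ≤ 1 := by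
    intro a ha
    rw [← SimpleGraph.card_neighborFinset_eq_degree, Finset.card_le_one]
    intro b hb c hc
    have h1 : H.Adj a b := by simpa using hb
    have h1 : B.Adj a b := h1
    have h2 : H.Adj a c := by simpa using hc
    have h2 : B.Adj a c := h2
    rw [hB] at h1 h2
    apply Subtype.ext
    apply hC.proper a
    · rcases ha with ha | ha
      · rw [h1.resolve_left (ha _), h2.resolve_left (ha _)]
      · rw [h1.resolve_right (ha _), h2.resolve_right (ha _)]
    · rcases h1 with h | h <;> rw [h] <;> assumption
  have mu : u ∈ K.supp := by simp [K]
  have mv : v ∈ K.supp := by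
    simp only [K, SimpleGraph.ConnectedComponent.mem_supp_iff, SimpleGraph.ConnectedComponent.eq]
    exact h1.symm
  have mw : w ∈ K.supp := by
    simp only [K, SimpleGraph.ConnectedComponent.mem_supp_iff, SimpleGraph.ConnectedComponent.eq]
    exact h2.symm
  let S : Finset K.supp := {⟨u, mu⟩, ⟨v, mv⟩, ⟨w, mw⟩}
  have hS : S.card = 3 := by
    rw [Finset.card_eq_three]
    exact ⟨_, _, _, by simpa using huv, by simpa using huw, by simpa using hvw, rfl⟩
  have hbound : ∑ a, (H.degree a + if a ∈ S then 1 else 0) ≤ ∑ a : K.supp, 2 := by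
    apply Finset.sum_le_sum
    intro a _
    split_ifs with h
    · have : H.degree a ≤ 1 := by
        apply hdeg1
        simp only [S, Finset.mem_insert, Finset.mem_singleton] at h
        rcases h with rfl | rfl | rfl
        · exact Or.inl hu
        · exact Or.inr hv
        · exact Or.inr hw
      omega
    · exact hdeg2 a
  rw [Finset.sum_add_distrib, hsum] at hbound
  simp only [Finset.sum_ite_mem, Finset.univ_inter, Finset.sum_const, hS, smul_eq_mul,
    Finset.card_univ] at hbound
  omega

/-- Vizing's theorem, one edge extension step. -/
lemma extend {V : Type*} [Fintype V] (n : ℕ) (C : V → V → ℕ) (hC : PCol C n)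
    (hmiss : ∀ v, ∃ β, β ≠ 0 ∧ β ≤ n ∧ ∀ u, C v u ≠ β) (x y0 : V) (hxy : y0 ≠ x)
    (h0 : C x y0 = 0) :
    ∃ C', PCol C' n ∧ ∀ a b, C' a b ≠ 0 ↔ (C a b ≠ 0 ∨ s(a, b) = s(x, y0)) := by
  classical
  -- fans
  let Fan : ℕ → (ℕ → V) → Prop := fun k y => y 0 = y0 ∧
    (∀ i ≤ k, ∀ j ≤ k, y i = y j → i = j) ∧
    (∀ i < k, C x (y (i + 1)) ≠ 0 ∧ ∀ u, C (y i) u ≠ C x (y (i + 1)))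
  have hcard : ∀ k y, Fan k y → k ≤ Fintype.card V := by
    intro k y ⟨_, hinj, _⟩
    have : (Finset.range (k + 1)).card ≤ (Finset.univ : Finset V).card := by
      apply Finset.card_le_card_of_injOn y (by simp)
      intro i hi j hj hij
      simp only [Finset.coe_range, Set.mem_Iio] at hi hj
      exact hinj i (by omega) j (by omega) hij
    rw [Finset.card_range, Finset.card_univ] at this
    omega
  have hfan0 : ∃ y, Fan 0 y := ⟨fun _ => y0, rfl, by intros; omega, by intros; omega⟩
  let k := Nat.findGreatest (fun k => ∃ y, Fan k y) (Fintype.card V)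
  obtain ⟨y, hy0, hinj, hfan⟩ : ∃ y, Fan k y :=
    Nat.findGreatest_spec (P := fun k => ∃ y, Fan k y) (Nat.zero_le _) hfan0
  have hmax : ∀ y, ¬ Fan (k + 1) y := by
    intro y' hy'
    have := Nat.le_findGreatest (P := fun k => ∃ y, Fan k y) (hcard _ _ hy') ⟨y', hy'⟩
    change k + 1 ≤ k at this
    omega
  have hyx : ∀ i ≤ k, y i ≠ x := by
    intro i hi h
    rcases i with _ | i
    · exact hxy (hy0 ▸ h)
    · apply (hfan i (by omega)).1
      rw [h, hC.diag]
  obtain ⟨α, hα, hαn, hαx⟩ := hmiss x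
  obtain ⟨β, hβ, hβn, hβk⟩ := hmiss (y k)
  subst hy0
  by_cases hβx : ∀ u, C x u ≠ β
  · exact shift n x β hβ hβn k C hC y hinj hyx h0 hfan hβx hβk
  push Not at hβx
  obtain ⟨z, hz⟩ := hβx
  have hzmem : ∃ j ≤ k, y j = z := by
    by_contra hno
    push Not at hno
    apply hmax (fun i => if i = k + 1 then z else y i)
    refine ⟨by simp, ?_, ?_⟩
    · intro i hi j hj hij
      dsimp only at hij
      split_ifs at hij with h1 h2 h2
      · omega
      · exact absurd hij.symm (hno j (by omega))
      · exact absurd hij (hno i (by omega))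
      · exact hinj i (by omega) j (by omega) hij
    · intro i hi
      have h1 : i ≠ k + 1 := by omega
      by_cases h2 : i = k
      · subst h2
        simp only [h1, if_true, if_false, hz]
        exact ⟨hβ, hβk⟩
      · have h3 : i + 1 ≠ k + 1 := by omega
        simp only [h1, h3, if_false]
        exact hfan i (by omega)
  obtain ⟨j, hjk, rfl⟩ := hzmem
  rcases j with _ | j
  · exact absurd (h0.symm.trans hz) hβ.symm
  have hβj : ∀ u, C (y j) u ≠ β := by
    have := (hfan j (by omega)).2
    rwa [hz] at this
  have hαβ : α ≠ β := by
    rintro rfl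
    exact hαx _ hz
  have hjk' : y j ≠ y k := fun h => by
    have := hinj j (by omega) k le_rfl h
    omega
  let B : SimpleGraph V :=
    { Adj := fun a b => C a b = α ∨ C a b = β
      symm := ⟨fun a b h => by rwa [hC.symm b a]⟩
      loopless := ⟨fun a h => by
        rw [hC.diag] at h
        rcases h with h | h
        · exact hα h.symm
        · exact hβ h.symm⟩ }
  have hB : ∀ a b, B.Adj a b ↔ (C a b = α ∨ C a b = β) := fun _ _ => Iff.rfl
  have key : ¬ (B.Reachable x (y j) ∧ B.Reachable x (y k)) := fun h =>
    three_ends C n hC α β hα hβ B hB x (y j) (y k) (hyx j (by omega)).symm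
      (hyx k le_rfl).symm hjk' hαx hβj hβk h.1 h.2
  -- a common step: swap at the component of `y m`
  have step : ∀ m ≤ k, (∀ u, C (y m) u ≠ β) → ¬ B.Reachable x (y m) →
      (∀ i < m, C x (y (i + 1)) = β → ¬ B.Reachable (y m) (y i)) →
      ∃ C', PCol C' n ∧ ∀ a b, C' a b ≠ 0 ↔ (C a b ≠ 0 ∨ s(a, b) = s(x, y 0)) := by
    intro m hm hβm hxm hbad
    obtain ⟨C1, hC1, hsupp, hout, hin⟩ := kempe C n hC α β hα hβ hαn hβn
      {a | B.Reachable (y m) a} (fun a b hab ha =>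
        SimpleGraph.Reachable.trans ha (SimpleGraph.Adj.reachable ((hB a b).2 hab)))
    have hxo : ∀ b, C1 x b = C x b := hout x (fun h => hxm (SimpleGraph.Reachable.symm h))
    obtain ⟨C', hC', hs'⟩ := shift n x α hα hαn m C1 hC1 y
      (fun i hi j hj => hinj i (by omega) j (by omega)) (fun i hi => hyx i (by omega))
      (by rw [hxo]; exact h0)
      (fun i hi => by
        rw [hxo]
        obtain ⟨h1, h2⟩ := hfan i (by omega)
        refine ⟨h1, fun u => ?_⟩
        by_cases hr : B.Reachable (y m) (y i)
        · rw [hin (y i) hr]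
          have hb : C x (y (i + 1)) ≠ β := fun h => hbad i hi h hr
          have ha : C x (y (i + 1)) ≠ α := hαx _
          intro h
          apply h2 u
          rw [← Equiv.swap_apply_of_ne_of_ne ha hb] at h
          exact (Equiv.swap α β).injective h
        · rw [hout (y i) hr]
          exact h2 u)
      (fun u => by rw [hxo]; exact hαx u)
      (fun u => by
        rw [hin (y m) (SimpleGraph.Reachable.refl _)]
        intro h
        apply hβm u
        apply (Equiv.swap α β).injective
        rw [h, Equiv.swap_apply_right])
    refine ⟨C', hC', fun a b => ?_⟩
    rw [hs', Ne, hsupp]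
  have huniq : ∀ i < k, C x (y (i + 1)) = β → i = j := by
    intro i hi h
    have := hC.proper x (y (i + 1)) (y (j + 1)) (by rw [h, hz]) (by rw [h]; exact hβ)
    have := hinj _ (by omega) _ (by omega) this
    omega
  by_cases hj : B.Reachable x (y j)
  · have hk : ¬ B.Reachable x (y k) := fun h => key ⟨hj, h⟩
    apply step k le_rfl hβk hk
    intro i hi h hr
    rw [huniq i hi h] at hr
    exact hk (hj.trans hr.symm)
  · apply step j (by omega) hβj hj
    intro i hi h
    have := huniq i (by omega) h
    omega

/-- Vizing's theorem. -/
lemma vizing {V : Type*} [Fintype V] (G : SimpleGraph V) (r : ℕ)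
    (hr : ∀ v, vertDegree G v ≤ r) :
    ∃ f : Sym2 V → ℕ, IsProperEdgeColoring G f ∧ ∀ e, f e < r + 1 := by
  classical
  have main : ∀ S : Finset (Sym2 V), (∀ e ∈ S, e ∈ G.edgeSet) →
      ∃ C : V → V → ℕ, PCol C (r + 1) ∧ ∀ a b, C a b ≠ 0 ↔ s(a, b) ∈ S := by
    intro S
    induction S using Finset.induction_on with
    | empty =>
      intro _
      exact ⟨fun _ _ => 0, ⟨by simp, by simp, by simp, by simp⟩, by simp⟩
    | insert e S he ih =>
      intro hS
      obtain ⟨C, hC, hsupp⟩ := ih (fun e' he' => hS e' (Finset.mem_insert_of_mem he'))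
      induction e using Sym2.ind with
      | _ x y =>
      have hxy : G.Adj x y := hS _ (Finset.mem_insert_self _ _)
      obtain ⟨C', hC', hs'⟩ := extend (r + 1) C hC (fun v => by
        by_contra hno
        push Not at hno
        have hsub : (Finset.Icc 1 (r + 1) : Set ℕ) ⊆ (fun u => C v u) '' G.neighborSet v := by
          intro β hβ
          simp only [Finset.coe_Icc, Set.mem_Icc] at hβ
          obtain ⟨u, hu⟩ := hno β (by omega) hβ.2
          refine ⟨u, ?_, hu⟩
          have : C v u ≠ 0 := by omega
          rw [hsupp] at this
          exact hS _ (Finset.mem_insert_of_mem this)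
        have h1 := Set.ncard_le_ncard hsub (Set.toFinite _)
        have h2 := Set.ncard_image_le (f := fun u => C v u) (Set.toFinite (G.neighborSet v))
        have h3 := hr v
        rw [Set.ncard_coe_finset, Nat.card_Icc] at h1
        rw [vertDegree] at h3
        omega) x y hxy.ne' (by
          by_contra h
          exact he ((hsupp _ _).1 h))
      refine ⟨C', hC', fun a b => ?_⟩
      rw [hs', hsupp, Finset.mem_insert, or_comm]
  obtain ⟨C, hC, hsupp⟩ := main (Finset.univ.filter (· ∈ G.edgeSet)) (by simp)
  refine ⟨Sym2.lift ⟨fun a b => C a b - 1, fun a b => by simp only [hC.symm a b]⟩, ?_, ?_⟩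
  · rw [proper_iff]
    intro v a b ha hb hab h
    simp only [Sym2.lift_mk] at h
    have h1 : C v a ≠ 0 := (hsupp _ _).2 (by simpa using ha)
    have h2 : C v b ≠ 0 := (hsupp _ _).2 (by simpa using hb)
    exact hab (hC.proper v a b (by omega) h1)
  · intro e
    induction e using Sym2.ind with
    | _ a b =>
    have := hC.bound a b
    simp only [Sym2.lift_mk]
    omega

/-- Cyclic predecessor in `{0, …, s-1}`. -/
def pr (s i : ℕ) : ℕ := if i = 0 then s - 1 else i - 1

lemma sub_val_eq_one {s : ℕ} (hs : 3 ≤ s) (u v : Fin s) :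
    (u - v).val = 1 ↔ v.val = pr s u.val := by
  have hu := u.isLt
  have hv := v.isLt
  rw [Fin.val_sub, pr]
  by_cases h : v.val ≤ u.val
  · have : s - v.val + u.val = s + (u.val - v.val) := by omega
    rw [this, Nat.add_mod_left, Nat.mod_eq_of_lt (by omega)]
    split_ifs <;> omega
  · rw [Nat.mod_eq_of_lt (by omega)]
    split_ifs <;> omega

lemma cycle_adj {s : ℕ} (hs : 3 ≤ s) (u v : Fin s) :
    (cycleGraph s).Adj u v ↔ (v.val = pr s u.val ∨ u.val = pr s v.val) := by
  rw [cycleGraph_adj', sub_val_eq_one hs, sub_val_eq_one hs]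

lemma prod_degree {V : Type*} [Fintype V] (G : SimpleGraph V) (r s : ℕ) (hs : 3 ≤ s)
    (hr : IsRegularDeg G r) : IsRegularDeg (cycleGraph s □ G) (r + 2) := by
  classical
  obtain ⟨n, rfl⟩ : ∃ n, s = n + 3 := ⟨s - 3, by omega⟩
  intro x
  have h1 := hr x.2
  rw [vertDegree, Set.ncard_eq_toFinset_card'] at h1 ⊢
  have h2 : (cycleGraph (n + 3) □ G).degree x = _ := degree_boxProd x
  have h3 : (cycleGraph (n + 3)).degree x.1 = 2 := cycleGraph_degree_three_le
  have h4 : G.degree x.2 = r := h1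
  have h5 : (cycleGraph (n + 3) □ G).degree x = r + 2 := by rw [h2, h3, h4]; omega
  rw [← h5, SimpleGraph.degree, neighborFinset]

/-- Gluing colorings of the copies of `G` and of the fibers. -/
lemma prod_coloring {V : Type*} (G : SimpleGraph V) (s : ℕ) (hs : 3 ≤ s)
    (h : ℕ → Sym2 V → ℕ) (φ : ℕ → V → ℕ)
    (hh : ∀ i < s, IsProperEdgeColoring G (h i))
    (hφ : ∀ i < s, ∀ v, φ i v ≠ φ (pr s i) v)
    (h1 : ∀ i < s, ∀ v, φ i v ∉ palette G (h i) v)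
    (h2 : ∀ i < s, ∀ v, φ (pr s i) v ∉ palette G (h i) v) :
    ∃ f, IsProperEdgeColoring (cycleGraph s □ G) f ∧
      ∀ x : Fin s × V, palette (cycleGraph s □ G) f x =
        palette G (h x.1) x.2 ∪ {φ x.1 x.2, φ (pr s x.1) x.2} := by
  classical
  have prne : ∀ i < s, pr s i ≠ i := by
    intro i hi; unfold pr; split_ifs <;> omega
  have prne2 : ∀ i < s, pr s (pr s i) ≠ i := by
    intro i hi; unfold pr; split_ifs <;> omega
  have prlt : ∀ i < s, pr s i < s := by
    intro i hi; unfold pr; split_ifs <;> omega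
  have prinj : ∀ i < s, ∀ j < s, pr s i = pr s j → i = j := by
    intro i hi j hj; unfold pr; split_ifs <;> omega
  have prsurj : ∀ i < s, ∃ j < s, pr s j = i := by
    intro i hi
    by_cases hi' : i = s - 1
    · exact ⟨0, by omega, by simp [pr, hi']⟩
    · exact ⟨i + 1, by omega, by simp [pr]⟩
  let c : Fin s × V → Fin s × V → ℕ := fun p q =>
    if p.1.val = q.1.val then h p.1 s(p.2, q.2)
    else if p.1.val = pr s q.1 then φ p.1 p.2
    else if q.1.val = pr s p.1 then φ q.1 q.2 else 0
  have hc : ∀ p q, c p q = c q p := by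
    intro p q
    have e1 := prne2 p.1 p.1.isLt
    have e2 := prne2 q.1 q.1.isLt
    simp only [c]
    by_cases h0 : p.1.val = q.1.val
    · rw [if_pos h0, if_pos h0.symm, h0, Sym2.eq_swap]
    · rw [if_neg h0, if_neg (Ne.symm h0)]
      by_cases h1 : p.1.val = pr s q.1
      · have h2 : q.1.val ≠ pr s p.1 := fun h2 => e2 (by rw [← h1, ← h2])
        rw [if_pos h1, if_neg h2, if_pos h1]
      · rw [if_neg h1, if_neg h1]
  let f : Sym2 (Fin s × V) → ℕ := Sym2.lift ⟨c, hc⟩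
  have hf : ∀ p q, f s(p, q) = c p q := fun _ _ => rfl
  -- classification of the neighbours
  have hadj : ∀ p q : Fin s × V, (cycleGraph s □ G).Adj p q →
      (p.1 = q.1 ∧ G.Adj p.2 q.2 ∧ f s(p, q) = h p.1 s(p.2, q.2)) ∨
      (p.2 = q.2 ∧ q.1.val = pr s p.1 ∧ f s(p, q) = φ (pr s p.1) p.2) ∨
      (p.2 = q.2 ∧ p.1.val = pr s q.1 ∧ f s(p, q) = φ p.1 p.2) := by
    intro p q hpq
    rw [boxProd_adj, cycle_adj hs] at hpq
    rw [hf]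
    have e1 := prne2 p.1 p.1.isLt
    have e2 := prne2 q.1 q.1.isLt
    have e3 := prne p.1 p.1.isLt
    have e4 := prne q.1 q.1.isLt
    rcases hpq with ⟨h | h, he⟩ | ⟨ha, he⟩
    · right; left
      refine ⟨he, h, ?_⟩
      simp only [c]
      rw [if_neg (by omega), if_neg (by rw [h]; exact fun h => e1 h.symm), if_pos h, h, he]
    · right; right
      refine ⟨he, h, ?_⟩
      simp only [c]
      rw [if_neg (by omega), if_pos h]
    · left
      refine ⟨he, ha, ?_⟩
      simp only [c]
      rw [if_pos (by rw [he])]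
  refine ⟨f, ?_, ?_⟩
  · rw [proper_iff]
    intro p a b ha hb hab heq
    have mem : ∀ q : V, G.Adj p.2 q → h p.1 s(p.2, q) ∈ palette G (h p.1) p.2 :=
      fun q hq => (mem_palette _ _ _ _).2 ⟨q, hq, rfl⟩
    have k1 := h1 p.1 p.1.isLt p.2
    have k2 := h2 p.1 p.1.isLt p.2
    have k3 := hφ p.1 p.1.isLt p.2
    rcases hadj p a ha with ⟨a1, a2, a3⟩ | ⟨a1, a2, a3⟩ | ⟨a1, a2, a3⟩ <;>
      rcases hadj p b hb with ⟨b1, b2, b3⟩ | ⟨b1, b2, b3⟩ | ⟨b1, b2, b3⟩ <;>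
      rw [a3, b3] at heq
    · refine (proper_iff _ _).1 (hh p.1 p.1.isLt) p.2 a.2 b.2 a2 b2 ?_ heq
      exact fun h => hab (Prod.ext (a1.symm.trans b1) h)
    · exact k2 (heq ▸ mem _ a2)
    · exact k1 (heq ▸ mem _ a2)
    · exact k2 (heq ▸ mem _ b2)
    · exact hab (Prod.ext (Fin.ext (a2.trans b2.symm)) (a1.symm.trans b1))
    · exact k3 heq.symm
    · exact k1 (heq ▸ mem _ b2)
    · exact k3 heq
    · exact hab (Prod.ext (Fin.ext (prinj _ a.1.isLt _ b.1.isLt (a2.symm.trans b2)))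
        (a1.symm.trans b1))
  · intro p
    ext col
    rw [mem_palette]
    constructor
    · rintro ⟨q, hq, rfl⟩
      rcases hadj p q hq with ⟨a1, a2, a3⟩ | ⟨a1, a2, a3⟩ | ⟨a1, a2, a3⟩ <;> rw [a3]
      · exact Or.inl ((mem_palette _ _ _ _).2 ⟨q.2, a2, rfl⟩)
      · simp
      · simp
    · rintro (hcol | hcol | hcol)
      · obtain ⟨a, ha, rfl⟩ := (mem_palette _ _ _ _).1 hcol
        refine ⟨(p.1, a), ?_, ?_⟩
        · rw [boxProd_adj]
          exact Or.inr ⟨ha, rfl⟩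
        · rw [hf]
          simp [c]
      · obtain ⟨j, hj, hjp⟩ := prsurj p.1 p.1.isLt
        have e := prne j hj
        refine ⟨(⟨j, hj⟩, p.2), ?_, ?_⟩
        · rw [boxProd_adj, cycle_adj hs]
          exact Or.inl ⟨Or.inr hjp.symm, rfl⟩
        · rw [hf, hcol]
          simp only [c]
          rw [if_neg (by omega), if_pos hjp.symm]
      · have hcol : col = φ (pr s p.1) p.2 := hcol
        have e := prne p.1 p.1.isLt
        have e1 := prne2 p.1 p.1.isLt
        refine ⟨(⟨pr s p.1, prlt _ p.1.isLt⟩, p.2), ?_, ?_⟩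
        · rw [boxProd_adj, cycle_adj hs]
          exact Or.inl ⟨Or.inl rfl, rfl⟩
        · rw [hf, hcol]
          simp only [c]
          rw [if_neg (by omega), if_neg (by omega), if_pos trivial]

lemma exists_missing {V : Type*} [Finite V] (G : SimpleGraph V) (f : Sym2 V → ℕ) (r : ℕ)
    (hf : IsProperEdgeColoring G f) (hr : IsRegularDeg G r) (v : V) :
    ∃ c < r + 1, c ∉ palette G f v := by
  by_contra hno
  push Not at hno
  have hsub : (Finset.range (r + 1) : Set ℕ) ⊆ palette G f v := by
    intro c hc
    exact hno c (by simpa using hc)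
  have hfin := palette_finite G f v
  have h1 := Set.ncard_le_ncard hsub hfin
  rw [palette_ncard G f hf, hr v, Set.ncard_coe_finset, Finset.card_range] at h1
  omega

lemma even_case {V : Type*} [Fintype V] [Nonempty V] (G : SimpleGraph V) (r s : ℕ) (hs : 3 ≤ s)
    (hr : IsRegularDeg G r) (heven : s % 2 = 0) : paletteIndex (cycleGraph s □ G) = 1 := by
  obtain ⟨g, hg, hgr⟩ := vizing G r (fun v => (hr v).le)
  choose m hm hm' using exists_missing G g r hg hr
  have hlt : ∀ v, ∀ c ∈ palette G g v, c < r + 1 := by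
    intro v c hc
    obtain ⟨a, _, rfl⟩ := (mem_palette _ _ _ _).1 hc
    exact hgr _
  have hnot : ∀ v, r + 1 ∉ palette G g v := fun v h => absurd (hlt v _ h) (by omega)
  obtain ⟨f, hf, hpal⟩ := prod_coloring G s hs (fun _ => g)
    (fun i v => if i % 2 = 0 then m v else r + 1) (fun _ _ => hg)
    (fun i hi v => by
      have := hm v
      unfold pr
      split_ifs <;> omega)
    (fun i hi v => by
      split_ifs
      · exact hm' v
      · exact hnot v)
    (fun i hi v => by
      split_ifs
      · exact hm' v
      · exact hnot v)
  haveI : Nonempty (Fin s × V) := ⟨(⟨0, by omega⟩, Classical.arbitrary V)⟩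
  refine paletteIndex_eq_one _ f hf (Finset.range (r + 2)) (fun x => ?_)
  apply palette_eq_of_subset _ f hf
  · rw [prod_degree G r s hs hr, Finset.card_range]
  · intro c hc
    rw [hpal, Set.mem_union, Set.mem_insert_iff, Set.mem_singleton_iff] at hc
    rw [Finset.mem_range]
    have h3 := hm x.2
    rcases hc with hc | hc | hc
    · have := hlt _ _ hc
      omega
    · split_ifs at hc <;> omega
    · split_ifs at hc <;> omega

lemma class1_case {V : Type*} [Fintype V] [Nonempty V] (G : SimpleGraph V) (r s : ℕ) (hs : 3 ≤ s)
    (hr : IsRegularDeg G r) (hr1 : 1 ≤ r) (hodd : s % 2 = 1) (g : Sym2 V → ℕ)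
    (hg : IsProperEdgeColoring G g) (hgr : ∀ e ∈ G.edgeSet, g e < r) :
    paletteIndex (cycleGraph s □ G) = 1 := by
  have hlt : ∀ v, ∀ c ∈ palette G g v, c < r := by
    rintro v c ⟨e, he, _, rfl⟩
    exact hgr e he
  let τ : ℕ → ℕ → ℕ := fun i c =>
    if c = 0 then (if i = 0 then r + 1 else if i = s - 1 then r else 0) else c
  have hτ : ∀ i v, ∀ c ∈ palette G (fun e => τ i (g e)) v,
      (0 < c ∧ c < r) ∨ c = τ i 0 := by
    intro i v c hc
    rw [palette_comp] at hc
    obtain ⟨d, hd, rfl⟩ := hc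
    have := hlt v d hd
    by_cases h0 : d = 0
    · right; rw [h0]
    · left
      simp only [τ, h0, if_false]
      omega
  let ψ : ℕ → ℕ := fun i => if i = s - 1 then 0 else if i % 2 = 0 then r else r + 1
  have hψ : ∀ i < s, ψ i ≠ ψ (pr s i) ∧ ψ i ≠ τ i 0 ∧ ψ (pr s i) ≠ τ i 0 ∧
      ¬ (0 < ψ i ∧ ψ i < r) ∧ ¬ (0 < ψ (pr s i) ∧ ψ (pr s i) < r) := by
    intro i hi
    simp only [ψ, τ, pr]
    split_ifs <;> omega
  obtain ⟨f, hf, hpal⟩ := prod_coloring G s hs (fun i e => τ i (g e)) (fun i _ => ψ i)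
    (fun i hi => by
      apply proper_comp G g _ hg
      intro v a ha b hb hab
      have h1 := hlt v a ha
      have h2 := hlt v b hb
      simp only [τ] at hab
      split_ifs at hab <;> omega)
    (fun i hi v => (hψ i hi).1)
    (fun i hi v h => by
      have := hτ i v _ h
      have := hψ i hi
      tauto)
    (fun i hi v h => by
      have := hτ i v _ h
      have := hψ i hi
      tauto)
  haveI : Nonempty (Fin s × V) := ⟨(⟨0, by omega⟩, Classical.arbitrary V)⟩
  refine paletteIndex_eq_one _ f hf (Finset.range (r + 2)) (fun x => ?_)
  apply palette_eq_of_subset _ f hf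
  · rw [prod_degree G r s hs hr, Finset.card_range]
  · intro c hc
    rw [hpal, Set.mem_union, Set.mem_insert_iff, Set.mem_singleton_iff] at hc
    rw [Finset.mem_range]
    rcases hc with hc | hc | hc
    · rcases hτ _ _ _ hc with h | h
      · omega
      · simp only [τ] at h
        split_ifs at h <;> omega
    · simp only [ψ] at hc
      split_ifs at hc <;> omega
    · simp only [ψ] at hc
      split_ifs at hc <;> omega

lemma odd_bound {V : Type*} [Fintype V] (G : SimpleGraph V) (r s : ℕ) (hs : 3 ≤ s)
    (hr : IsRegularDeg G r) (hodd : s % 2 = 1) :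
    paletteIndex (cycleGraph s □ G) ≤ paletteIndex G + 2 := by
  obtain ⟨g, hg, hgr⟩ := vizing G r (fun v => (hr v).le)
  choose m hm hm' using exists_missing G g r hg hr
  obtain ⟨f₀, hf₀, hpi⟩ := paletteIndex_spec G
  obtain ⟨N, hN⟩ : ∃ N, ∀ e, f₀ e < N := by
    obtain ⟨N, hN⟩ := (Set.finite_range f₀).bddAbove
    exact ⟨N + 1, fun e => Nat.lt_succ_of_le (hN ⟨e, rfl⟩)⟩
  let X := N + r + 1
  have hlt : ∀ v, ∀ c ∈ palette G g v, c < r + 1 := by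
    intro v c hc
    obtain ⟨a, _, rfl⟩ := (mem_palette _ _ _ _).1 hc
    exact hgr _
  have hlt0 : ∀ v, ∀ c ∈ palette G f₀ v, c < N := by
    intro v c hc
    obtain ⟨a, _, rfl⟩ := (mem_palette _ _ _ _).1 hc
    exact hN _
  let h : ℕ → Sym2 V → ℕ := fun i => if i = 0 then f₀ else g
  have hX : ∀ i v, ∀ c, X ≤ c → c ∉ palette G (h i) v := by
    intro i v c hXc hc
    simp only [h] at hc
    split_ifs at hc
    · have := hlt0 v _ hc
      omega
    · have := hlt v _ hc
      omega
  let φ : ℕ → V → ℕ := fun i v => if i = s - 1 then X + 1 else if i % 2 = 0 then X else m v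
  have hφcase : ∀ i < s, ∀ v,
      (i = 0 ∧ φ i v = X ∧ φ (pr s i) v = X + 1) ∨
      (i ≠ 0 ∧ φ i v = X ∧ φ (pr s i) v = m v) ∨
      (i ≠ 0 ∧ φ i v = m v ∧ φ (pr s i) v = X) ∨
      (i ≠ 0 ∧ φ i v = X + 1 ∧ φ (pr s i) v = m v) := by
    intro i hi v
    simp only [φ, pr]
    split_ifs <;> omega
  have hmm : ∀ i ≠ 0, ∀ v, m v ∉ palette G (h i) v := by
    intro i hi v
    simp only [h, hi, if_false]
    exact hm' v
  obtain ⟨f, hf, hpal⟩ := prod_coloring G s hs h φ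
    (fun i hi => by
      simp only [h]
      split_ifs
      · exact hf₀
      · exact hg)
    (fun i hi v => by
      have := hm v
      have := hφcase i hi v
      omega)
    (fun i hi v => by
      rcases hφcase i hi v with ⟨h0, h1, h2⟩ | ⟨h0, h1, h2⟩ | ⟨h0, h1, h2⟩ | ⟨h0, h1, h2⟩ <;> rw [h1]
      · exact hX _ _ _ (by omega)
      · exact hX _ _ _ (by omega)
      · exact hmm i h0 v
      · exact hX _ _ _ (by omega))
    (fun i hi v => by
      rcases hφcase i hi v with ⟨h0, h1, h2⟩ | ⟨h0, h1, h2⟩ | ⟨h0, h1, h2⟩ | ⟨h0, h1, h2⟩ <;> rw [h2]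
      · exact hX _ _ _ (by omega)
      · exact hmm i h0 v
      · exact hX _ _ _ (by omega)
      · exact hmm i h0 v)
  refine (paletteIndex_le _ f hf).trans ?_
  rw [← hpi, numPalettes, numPalettes]
  have hpalc : ∀ x : Fin s × V, ∀ c ∈ palette (cycleGraph s □ G) f x, x.1.val ≠ 0 →
      c < r + 1 ∨ c = φ x.1 x.2 ∨ c = φ (pr s x.1) x.2 := by
    intro x c hc hx
    rw [hpal, Set.mem_union, Set.mem_insert_iff, Set.mem_singleton_iff] at hc
    rcases hc with hc | hc
    · left
      simp only [h, hx, if_false] at hc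
      exact hlt _ _ hc
    · exact Or.inr hc
  have hfull : ∀ x : Fin s × V, ∀ c, r < c →
      (∀ d ∈ palette (cycleGraph s □ G) f x, d < r + 1 ∨ d = c) →
      palette (cycleGraph s □ G) f x = ↑(insert c (Finset.range (r + 1))) := by
    intro x c hrc hsub
    apply palette_eq_of_subset _ f hf
    · rw [prod_degree G r s hs hr]
      refine (Finset.card_insert_le _ _).trans ?_
      rw [Finset.card_range]
    · intro d hd
      rw [Finset.mem_insert, Finset.mem_range]
      exact (hsub d hd).symm
  have hsub : Set.range (palette (cycleGraph s □ G) f) ⊆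
      ((fun P => P ∪ {X, X + 1}) '' Set.range (palette G f₀)) ∪
        {(↑(insert X (Finset.range (r + 1))) : Set ℕ),
          (↑(insert (X + 1) (Finset.range (r + 1))) : Set ℕ)} := by
    rintro _ ⟨x, rfl⟩
    have hmx := hm x.2
    rcases hφcase x.1 x.1.isLt x.2 with ⟨h0, h1, h2⟩ | ⟨h0, h1, h2⟩ | ⟨h0, h1, h2⟩ | ⟨h0, h1, h2⟩
    · left
      refine ⟨_, ⟨x.2, rfl⟩, ?_⟩
      rw [hpal, h1, h2, h0]
      simp only [h, if_true]
    · right; left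
      apply hfull x X (by omega)
      intro d hd
      have := hpalc x d hd h0
      omega
    · right; left
      apply hfull x X (by omega)
      intro d hd
      have := hpalc x d hd h0
      omega
    · right; right
      apply hfull x (X + 1) (by omega)
      intro d hd
      have := hpalc x d hd h0
      omega
  have hfinr : (Set.range (palette G f₀)).Finite := Set.finite_range _
  refine (Set.ncard_le_ncard hsub ((hfinr.image _).union (by simp))).trans ?_
  refine (Set.ncard_union_le _ _).trans ?_
  have e1 := Set.ncard_image_le (f := fun P : Set ℕ => P ∪ {X, X + 1}) hfinr
  have e2 : ({(↑(insert X (Finset.range (r + 1))) : Set ℕ),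
          (↑(insert (X + 1) (Finset.range (r + 1))) : Set ℕ)} : Set (Set ℕ)).ncard ≤ 2 :=
    (Set.ncard_insert_le _ _).trans (by rw [Set.ncard_singleton])
  omega

/-- Fiber colors for the cubic construction. -/
def E (k j : ℕ) : ℕ :=
  if k = 1 then (if j = 0 then 4 else if j = 1 then 1 else 5)
  else if k = 2 then (if j = 0 then 4 else if j = 1 then 5 else 2)
  else (if j = 0 then 3 else if j = 1 then 4 else 5)

/-- Transposition of `0` and `j`. -/
def tr (j c : ℕ) : ℕ := if c = 0 then j else if c = j then 0 else c

lemma table (k i a b : ℕ) (hk : k ≠ 0) (hk4 : k < 4)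
    (h : (i = 0 ∧ a = 0 ∧ b = 2) ∨ (i = 1 ∧ a = 1 ∧ b = 0) ∨ (i = 2 ∧ a = 2 ∧ b = 1) ∨
      (i = 2 ∧ a = 1 ∧ b = 2)) :
    E k a ≠ E k b ∧ E k a < 6 ∧ E k b < 6 ∧
    (∀ c < 4, c ≠ k → tr (i + 1) c < 4 ∧ tr (i + 1) c ≠ E k a ∧ tr (i + 1) c ≠ E k b) ∧
    ∃ t, (t = 0 ∨ t = 4 ∨ t = 5) ∧ t ≠ E k a ∧ t ≠ E k b ∧
      ∀ c < 4, c ≠ k → tr (i + 1) c ≠ t := by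
  obtain rfl | rfl | rfl : k = 1 ∨ k = 2 ∨ k = 3 := by omega
  all_goals
    rcases h with ⟨rfl, rfl, rfl⟩ | ⟨rfl, rfl, rfl⟩ | ⟨rfl, rfl, rfl⟩ | ⟨rfl, rfl, rfl⟩
  all_goals
    refine ⟨by decide, by decide, by decide, by decide, ?_⟩
    first
    | exact ⟨0, by decide, by decide, by decide, by decide⟩
    | exact ⟨4, by decide, by decide, by decide, by decide⟩
    | exact ⟨5, by decide, by decide, by decide, by decide⟩

lemma cubic_base {V : Type*} [Fintype V] (G : SimpleGraph V) (hr : IsRegularDeg G 3)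
    (M : Set (Sym2 V)) (hM : IsPerfectMatchingSet G M) :
    ∃ g, IsProperEdgeColoring G g ∧ (∀ e, g e < 4) ∧ ∀ v, 0 ∈ palette G g v := by
  classical
  obtain ⟨hMG, hMv⟩ := hM
  let F := G.deleteEdges M
  have hF : ∀ a b, F.Adj a b ↔ G.Adj a b ∧ s(a, b) ∉ M := by
    intro a b
    simp [F, SimpleGraph.deleteEdges_adj]
  have hpart : ∀ v, ∃ u, G.Adj v u ∧ s(v, u) ∈ M := by
    intro v
    obtain ⟨e, ⟨he, hv⟩, _⟩ := hMv v
    obtain ⟨u, rfl⟩ := hv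
    exact ⟨u, hMG he, he⟩
  have hdeg : ∀ v, vertDegree F v ≤ 2 := by
    intro v
    obtain ⟨u, hu, huM⟩ := hpart v
    have : F.neighborSet v ⊂ G.neighborSet v := by
      refine ⟨fun a ha => ((hF v a).1 ha).1, fun hsub => ?_⟩
      exact ((hF v u).1 (hsub hu)).2 huM
    have := Set.ncard_lt_ncard this (Set.toFinite _)
    have h3 := hr v
    unfold vertDegree at h3 ⊢
    omega
  obtain ⟨f, hf, hf3⟩ := vizing F 2 hdeg
  rw [proper_iff] at hf
  refine ⟨fun e => if e ∈ M then 0 else f e + 1, ?_, ?_, ?_⟩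
  · rw [proper_iff]
    intro v a b ha hb hab
    split_ifs with h1 h2 h2
    · intro _
      have := (hMv v).unique ⟨h1, by simp⟩ ⟨h2, by simp⟩
      exact hab (Sym2.congr_right.1 this)
    · omega
    · omega
    · have := hf v a b ((hF v a).2 ⟨ha, h1⟩) ((hF v b).2 ⟨hb, h2⟩) hab
      omega
  · intro e
    have := hf3 e
    dsimp only
    split_ifs <;> omega
  · intro v
    obtain ⟨u, hu, huM⟩ := hpart v
    rw [mem_palette]
    exact ⟨u, hu, by simp [huM]⟩

lemma cubic_bound {V : Type*} [Fintype V] (G : SimpleGraph V) (s : ℕ) (hs : 3 ≤ s)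
    (hr : IsRegularDeg G 3) (hodd : s % 2 = 1) (M : Set (Sym2 V))
    (hM : IsPerfectMatchingSet G M) : paletteIndex (cycleGraph s □ G) ≤ 3 := by
  obtain ⟨g, hg, hg4, hg0⟩ := cubic_base G hr M hM
  choose k hk4 hk' using exists_missing G g 3 hg hr
  have hk0 : ∀ v, k v ≠ 0 := fun v h => hk' v (h ▸ hg0 v)
  let idx : ℕ → ℕ := fun j => if j < 3 then j else if j % 2 = 1 then 1 else 2
  have htab : ∀ i < s, ∀ v, _ := fun i hi v =>
    table (k v) (min i 2) (idx i) (idx (pr s i)) (hk0 v) (hk4 v) (by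
      simp only [idx, pr]
      split_ifs <;> omega)
  have hpalg : ∀ i v, ∀ c ∈ palette G (fun e => tr (min i 2 + 1) (g e)) v,
      ∃ d < 4, d ≠ k v ∧ tr (min i 2 + 1) d = c := by
    intro i v c hc
    rw [palette_comp] at hc
    obtain ⟨d, hd, rfl⟩ := hc
    refine ⟨d, ?_, ?_, rfl⟩
    · obtain ⟨a, _, rfl⟩ := (mem_palette _ _ _ _).1 hd
      exact hg4 _
    · rintro rfl
      exact hk' v hd
  obtain ⟨f, hf, hpal⟩ := prod_coloring G s hs (fun i e => tr (min i 2 + 1) (g e))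
    (fun i v => E (k v) (idx i))
    (fun i hi => by
      apply proper_comp G g _ hg
      intro v a ha b hb hab
      unfold tr at hab
      split_ifs at hab <;> omega)
    (fun i hi v => (htab i hi v).1)
    (fun i hi v hmem => by
      obtain ⟨d, hd, hdk, he⟩ := hpalg i v _ hmem
      exact ((htab i hi v).2.2.2.1 d hd hdk).2.1 he)
    (fun i hi v hmem => by
      obtain ⟨d, hd, hdk, he⟩ := hpalg i v _ hmem
      exact ((htab i hi v).2.2.2.1 d hd hdk).2.2 he)
  refine (paletteIndex_le _ f hf).trans ?_
  let S : ℕ → Set ℕ := fun t => ↑((Finset.range 6).erase t)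
  have hsub : Set.range (palette (cycleGraph s □ G) f) ⊆
      (({S 0, S 4, S 5} : Finset (Set ℕ)) : Set (Set ℕ)) := by
    rintro _ ⟨x, rfl⟩
    obtain ⟨_, hA, hB, hT, t, ht, htA, htB, htT⟩ := htab x.1 x.1.isLt x.2
    have hSt : palette (cycleGraph s □ G) f x = S t := by
      apply palette_eq_of_subset _ f hf
      · rw [prod_degree G 3 s hs hr, Finset.card_erase_of_mem]
        · simp
        · rw [Finset.mem_range]; omega
      · intro c hc
        rw [hpal, Set.mem_union, Set.mem_insert_iff, Set.mem_singleton_iff] at hc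
        rw [Finset.mem_erase, Finset.mem_range]
        rcases hc with hc | hc | hc
        · obtain ⟨d, hd, hdk, rfl⟩ := hpalg _ _ _ hc
          have h1 := hT d hd hdk
          exact ⟨htT d hd hdk, by omega⟩
        · rw [hc]
          exact ⟨htA.symm, hA⟩
        · rw [hc]
          exact ⟨htB.symm, hB⟩
    rw [hSt]
    rcases ht with rfl | rfl | rfl <;> simp
  rw [numPalettes]
  refine (Set.ncard_le_ncard hsub (Finset.finite_toSet _)).trans ?_
  rw [Set.ncard_coe_finset]
  exact Finset.card_le_three

lemma class1_coloring {V : Type*} [Fintype V] [Nonempty V] (G : SimpleGraph V) (r : ℕ)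
    (hr : IsRegularDeg G r) (hc : IsClass1 G) :
    ∃ g, IsProperEdgeColoring G g ∧ ∀ e ∈ G.edgeSet, g e < r := by
  have hmax : maxDeg G = r := by
    have : Set.range (vertDegree G) = {r} := by
      ext d
      simp [hr _, eq_comm]
    rw [maxDeg, this, csSup_singleton]
  obtain ⟨g, hg, hgr⟩ := vizing G r (fun v => (hr v).le)
  have := Nat.sInf_mem (s := {n | ∃ f, IsProperEdgeColoring G f ∧ ∀ e ∈ G.edgeSet, f e < n})
    ⟨r + 1, g, hg, fun e _ => hgr e⟩
  have he : sInf {n | ∃ f, IsProperEdgeColoring G f ∧ ∀ e ∈ G.edgeSet, f e < n} = r := by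
    rw [← hmax]
    exact hc
  rw [he] at this
  exact this

end PalAux

/-- Let `G` be a finite regular simple graph with at least one edge
and `s ≥ 3`. Then (i) `š(C_s □ G) ≤ š(G) + 2`; (ii) if `s` is even or `G` is
class 1 then `š(C_s □ G) = 1`; (iii) if `G` is a class 2 cubic graph with a
perfect matching and `s` is odd then `š(C_s □ G) ∈ {1, 3}`. -/
theorem paletteIndex_cycle_boxProd_regular {V : Type*} [Fintype V] (G : SimpleGraph V)
    (s : ℕ) (hs : 3 ≤ s) (hreg : ∃ r, IsRegularDeg G r) (hG : G.edgeSet.Nonempty) :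
    paletteIndex (cycleGraph s □ G) ≤ paletteIndex G + 2 ∧
    (Even s ∨ IsClass1 G → paletteIndex (cycleGraph s □ G) = 1) ∧
    (IsRegularDeg G 3 ∧ ¬IsClass1 G ∧ (∃ M, IsPerfectMatchingSet G M) ∧ Odd s →
      paletteIndex (cycleGraph s □ G) ∈ ({1, 3} : Set ℕ)) := by
  obtain ⟨r, hr⟩ := hreg
  obtain ⟨e, he⟩ := hG
  induction e using Sym2.ind with
  | _ a b =>
  have hab : G.Adj a b := he
  haveI : Nonempty V := ⟨a⟩
  have hr1 : 1 ≤ r := by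
    rw [← hr a, vertDegree, Nat.succ_le_iff, Set.ncard_pos (Set.toFinite _)]
    exact ⟨b, hab⟩
  haveI : Nonempty (Fin s × V) := ⟨(⟨0, by omega⟩, a)⟩
  have hone := PalAux.one_le_paletteIndex (cycleGraph s □ G)
  refine ⟨?_, ?_, ?_⟩
  · rcases Nat.mod_two_eq_zero_or_one s with h | h
    · rw [PalAux.even_case G r s hs hr h]
      omega
    · exact PalAux.odd_bound G r s hs hr h
  · intro hor
    rcases Nat.mod_two_eq_zero_or_one s with h | h
    · exact PalAux.even_case G r s hs hr h
    · have hc : IsClass1 G := by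
        rcases hor with h' | h'
        · rw [Nat.even_iff] at h'
          omega
        · exact h'
      obtain ⟨g, hg, hgr⟩ := PalAux.class1_coloring G r hr hc
      exact PalAux.class1_case G r s hs hr hr1 h g hg hgr
  · rintro ⟨h3, _, ⟨M, hM⟩, hodd⟩
    have hle := PalAux.cubic_bound G s hs h3 (Nat.odd_iff.1 hodd) M hM
    have hne := PalAux.paletteIndex_ne_two (cycleGraph s □ G) 5 (PalAux.prod_degree G 3 s hs h3)
    simp only [Set.mem_insert_iff, Set.mem_singleton_iff]
    omega
end
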